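/- Generalized MacMahon's formula (Macdonald's case, boxed version): For every pair of positive integers r, c, the identity ∑_{π ∈ P(r,c)} F_π(q,t) s^{|π|} = ∏_{i=1}^{r} ∏_{j=1}^{c} (t s^{i+j-1}; q)_∞ / (s^{i+j-1}; q)_∞ holds, as an identity of formal power series in s whose coefficients are rational functions of q and t (equivalently, for real parameters 0 ≤ q, t, s < 1). -/

import Mathlib

open scoped BigOperators

/-- A plane partition: a filling of a Young diagram (its support) with positive
integers that are weakly decreasing along rows and columns.  Entries outside
the support are recorded as `0`, and rows and columns are indexed from `0`
(so box `(i, j)` is box `(i+1, j+1)` in the 1-indexed convention). -/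
structure PlanePartition where
  part : ℕ → ℕ → ℕ
  row_decr : ∀ i j, part i (j + 1) ≤ part i j
  col_decr : ∀ i j, part (i + 1) j ≤ part i j
  finite_supp : {p : ℕ × ℕ | part p.1 p.2 ≠ 0}.Finite

namespace PlanePartition

/-- The weight `|π|`: the sum of all entries of `π`. -/
noncomputable def weight (π : PlanePartition) : ℕ := ∑ᶠ p : ℕ × ℕ, π.part p.1 p.2

/-- The trace `tr(π)`: the sum of the diagonal entries of `π`. -/
noncomputable def trace (π : PlanePartition) : ℕ := ∑ᶠ i : ℕ, π.part i i

/-- A strict plane partition: all of the diagonal partitions of `π` have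
distinct parts, i.e. every diagonal of `π` is strictly decreasing where
nonzero. -/
def IsStrict (π : PlanePartition) : Prop :=
  ∀ i j, π.part i j ≠ 0 → π.part (i + 1) (j + 1) < π.part i j

end PlanePartition

/-- Two boxes of `ℕ × ℕ` are adjacent when they share an edge. -/
def Adjacent (p q : ℕ × ℕ) : Prop :=
  (p.1 = q.1 ∧ (p.2 + 1 = q.2 ∨ q.2 + 1 = p.2)) ∨
  (p.2 = q.2 ∧ (p.1 + 1 = q.1 ∨ q.1 + 1 = p.1))

/-- One step of connectivity for a filling `g` of boxes by natural numbers: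
adjacent boxes carrying the same nonzero entry. -/
def ConnStep (g : ℕ → ℕ → ℕ) (p q : ℕ × ℕ) : Prop :=
  Adjacent p q ∧ g p.1 p.2 = g q.1 q.2 ∧ g p.1 p.2 ≠ 0

/-- `p` and `q` belong to the same connected component of `g`: both are boxes
of the support and they are joined by a chain of adjacent boxes all filled
with the same number. -/
def SameComponent (g : ℕ → ℕ → ℕ) (p q : ℕ × ℕ) : Prop :=
  g p.1 p.2 ≠ 0 ∧ Relation.ReflTransGen (ConnStep g) p q

/-- The set of connected components of a filling `g`. -/
def components (g : ℕ → ℕ → ℕ) : Set (Set (ℕ × ℕ)) :=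
  {C | ∃ p : ℕ × ℕ, g p.1 p.2 ≠ 0 ∧ C = {q | SameComponent g p q}}

/-- `k(g)`: the number of connected components. -/
noncomputable def numComponents (g : ℕ → ℕ → ℕ) : ℕ := (components g).ncard

/-- The level `h(p)` of a box `p`: the smallest positive `h` such that the box
shifted diagonally by `h` does not belong to the same connected component. -/
noncomputable def level (g : ℕ → ℕ → ℕ) (p : ℕ × ℕ) : ℕ :=
  sInf {h : ℕ | 0 < h ∧ ¬ SameComponent g p (p.1 + h, p.2 + h)}

/-- One step of border connectivity: adjacent boxes with the same nonzero
entry and the same level. -/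
def BorderStep (g : ℕ → ℕ → ℕ) (p q : ℕ × ℕ) : Prop :=
  ConnStep g p q ∧ level g p = level g q

/-- `p` and `q` belong to the same border component. -/
def SameBorder (g : ℕ → ℕ → ℕ) (p q : ℕ × ℕ) : Prop :=
  g p.1 p.2 ≠ 0 ∧ Relation.ReflTransGen (BorderStep g) p q

/-- The set of border components of a filling `g` (each border component is a
maximal connected set of boxes with the same entry and the same level). -/
def borderComponents (g : ℕ → ℕ → ℕ) : Set (Set (ℕ × ℕ)) :=
  {B | ∃ p : ℕ × ℕ, g p.1 p.2 ≠ 0 ∧ B = {q | SameBorder g p q}}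

/-- The (common) level of the boxes of a border component `B`. -/
noncomputable def borderLevel (g : ℕ → ℕ → ℕ) (B : Set (ℕ × ℕ)) : ℕ :=
  sInf {h : ℕ | ∃ p ∈ B, level g p = h}

/-- The polynomial `A_π(t)`: the product over all border components `B` of
`π` of `(1 - t ^ level(B))`; equivalently the product over connected
components `C` of `P_C(t) = ∏_i (1 - t^i)^{n_i}` where `n_i` is the number of
`i`-level border components of `C`. -/
noncomputable def Apoly (t : ℝ) (π : PlanePartition) : ℝ :=
  ∏ᶠ B ∈ borderComponents π.part, (1 - t ^ borderLevel π.part B)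

/-- The function `f(n, m)` (for parameters `q`, `t`); the empty product gives
`f(0, m) = 1`. -/
noncomputable def fmac (q t : ℝ) (n m : ℕ) : ℝ :=
  ∏ i ∈ Finset.range n, (1 - q ^ i * t ^ (m + 1)) / (1 - q ^ (i + 1) * t ^ m)

/-- `F_π(i,j)(q,t)`, associated to the box `(i, j)` of `π`: with
`λ = (π(i,j), π(i+1,j+1), …)`, `μ = (π(i+1,j), π(i+2,j+1), …)` and
`ν = (π(i,j+1), π(i+1,j+2), …)`, this is
`∏_{m ≥ 0} f(λ₁-μ_{m+1},m) f(λ₁-ν_{m+1},m) / (f(λ₁-λ_{m+1},m) f(λ₁-λ_{m+2},m))`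
(only finitely many factors differ from `1`). -/
noncomputable def Fbox (q t : ℝ) (π : PlanePartition) (i j : ℕ) : ℝ :=
  ∏' m : ℕ,
    (fmac q t (π.part i j - π.part (i + 1 + m) (j + m)) m *
        fmac q t (π.part i j - π.part (i + m) (j + 1 + m)) m) /
      (fmac q t (π.part i j - π.part (i + m) (j + m)) m *
        fmac q t (π.part i j - π.part (i + m + 1) (j + m + 1)) m)

/-- `F_π(q,t)`: the product of `F_π(i,j)(q,t)` over all boxes `(i,j)` of the
support of `π`. -/
noncomputable def Fmac (q t : ℝ) (π : PlanePartition) : ℝ :=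
  ∏ᶠ p : ℕ × ℕ, if π.part p.1 p.2 ≠ 0 then Fbox q t π p.1 p.2 else 1

/-- The infinite `q`-Pochhammer symbol `(x; q)_∞ = ∏_{n ≥ 0} (1 - x qⁿ)`. -/
noncomputable def qPoch (x q : ℝ) : ℝ := ∏' n : ℕ, (1 - x * q ^ n)

/-- The product over `i ∈ J`, `j ∈ S \ J` of the pair weights `w i j`. -/
def cutWeight {ι K : Type*} [DecidableEq ι] [CommMonoid K] (w : ι → ι → K) (S J : Finset ι) : K :=
  ∏ i ∈ S, ∏ j ∈ S, if i ∈ J ∧ j ∉ J then w i j else 1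

theorem cutWeight_insert_left {ι K : Type*} [DecidableEq ι] [CommMonoid K] (w : ι → ι → K)
    {S J : Finset ι} {n : ι} (hn : n ∉ S) (hJ : J ⊆ S) :
    cutWeight w (insert n S) J = cutWeight w S J * ∏ i ∈ S, if i ∈ J then w i n else 1 := by
  have hnJ : n ∉ J := fun h => hn (hJ h)
  unfold cutWeight
  simp only [Finset.prod_insert hn, hnJ, false_and, if_false, Finset.prod_const_one, one_mul,
    not_false_eq_true, and_true]
  rw [Finset.prod_mul_distrib, mul_comm]

theorem cutWeight_insert_right {ι K : Type*} [DecidableEq ι] [CommMonoid K] (w : ι → ι → K)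
    {S J : Finset ι} {n : ι} (hn : n ∉ S) (hJ : J ⊆ S) :
    cutWeight w (insert n S) (insert n J) =
      cutWeight w S J * ∏ i ∈ S, if i ∈ J then 1 else w n i := by
  have hnJ : n ∉ J := fun h => hn (hJ h)
  have hS : ∀ i ∈ S, (i ∈ insert n J ↔ i ∈ J) := by
    intro i hi
    rw [Finset.mem_insert, or_iff_right]
    rintro rfl
    exact hn hi
  unfold cutWeight
  rw [Finset.prod_insert hn, Finset.prod_insert hn, mul_comm]
  simp only [Finset.mem_insert_self, not_true_eq_false, and_false, if_false, true_and]
  rw [one_mul]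
  congr 1
  · refine Finset.prod_congr rfl fun i hi => ?_
    rw [Finset.prod_insert hn]
    simp only [Finset.mem_insert_self, not_true_eq_false, and_false, if_false, one_mul]
    refine Finset.prod_congr rfl fun j hj => ?_
    simp only [hS i hi, hS j hj]
  · refine Finset.prod_congr rfl fun i hi => ?_
    simp only [hS i hi]
    by_cases h : i ∈ J <;> simp [h]

/-- The pair weight `(1 - q z) (1 - p z) / ((1 - z) (1 - q p z))` at `z = x / y`. -/
def pairWeight {K : Type*} [Field K] (q p x y : K) : K :=
  (y - q * x) * (y - p * x) / ((y - x) * (y - q * p * x))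

theorem pairWeight_reflect_left {K : Type*} [Field K] {q p : K} (hqp : q * p ≠ 0) (x y : K) :
    pairWeight q p (y / (q * p)) x = pairWeight q p x y := by
  have hq : q ≠ 0 := left_ne_zero_of_mul hqp
  have hp : p ≠ 0 := right_ne_zero_of_mul hqp
  unfold pairWeight
  have h1 : x - q * (y / (q * p)) = - (y - p * x) / p := by field_simp; ring
  have h2 : x - p * (y / (q * p)) = - (y - q * x) / q := by field_simp; ring
  have h3 : x - y / (q * p) = - (y - q * p * x) / (q * p) := by field_simp; ring
  have h4 : x - q * p * (y / (q * p)) = - (y - x) := by field_simp; ring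
  rw [h1, h2, h3, h4]
  have h5 : -(y - p * x) / p * (-(y - q * x) / q) = (y - q * x) * (y - p * x) / (q * p) := by
    field_simp
  have h6 : -(y - q * p * x) / (q * p) * -(y - x) =
      (y - x) * (y - q * p * x) / (q * p) := by
    field_simp
  rw [h5, h6, div_div_div_cancel_right₀ hqp]

theorem pairWeight_reflect_right {K : Type*} [Field K] {q p : K} (hqp : q * p ≠ 0) (x y : K) :
    pairWeight q p x (q * p * y) = pairWeight q p y x := by
  rw [← pairWeight_reflect_left hqp, mul_div_cancel_left₀ _ hqp]

open Polynomial in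
/-- The monic cubic with the given roots. -/
noncomputable def monicCubic {K : Type*} [Field K] (a b c : K) : K[X] :=
  (X - C a) * (X - C b) * (X - C c)

open Polynomial in
theorem monicCubic_spec {K : Type*} [Field K] (a b c : K) :
    (monicCubic a b c).Monic ∧ (monicCubic a b c).natDegree = 3 := by
  refine ⟨((monic_X_sub_C _).mul (monic_X_sub_C _)).mul (monic_X_sub_C _), ?_⟩
  rw [monicCubic, ((monic_X_sub_C _).mul (monic_X_sub_C _)).natDegree_mul (monic_X_sub_C _),
    (monic_X_sub_C _).natDegree_mul (monic_X_sub_C _), natDegree_X_sub_C, natDegree_X_sub_C,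
    natDegree_X_sub_C]

open Polynomial in
theorem eval_monicCubic {K : Type*} [Field K] (a b c z : K) :
    (monicCubic a b c).eval z = (z - a) * (z - b) * (z - c) := by
  simp [monicCubic]

theorem prod_ite_one_mul_prod_ite {ι K : Type*} [DecidableEq ι] [CommMonoid K] (R J : Finset ι)
    {a b c d : ι → K} (h : ∀ i ∈ R, i ∈ J → a i * b i = c i) (h' : ∀ i ∈ R, i ∉ J → d i = c i) :
    (∏ i ∈ R, if i ∈ J then a i else 1) * (∏ i ∈ R, if i ∈ J then b i else d i) =
      ∏ i ∈ R, c i := by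
  rw [← Finset.prod_mul_distrib]
  refine Finset.prod_congr rfl fun i hi => ?_
  by_cases hJ : i ∈ J
  · simp [hJ, h i hi hJ]
  · simp [hJ, h' i hi hJ]

theorem prod_ite_one_mul_prod_ite' {ι K : Type*} [DecidableEq ι] [CommMonoid K] (R J : Finset ι)
    {a b c d : ι → K} (h : ∀ i ∈ R, i ∉ J → a i * d i = c i) (h' : ∀ i ∈ R, i ∈ J → b i = c i) :
    (∏ i ∈ R, if i ∈ J then 1 else a i) * (∏ i ∈ R, if i ∈ J then b i else d i) =
      ∏ i ∈ R, c i := by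
  rw [← Finset.prod_mul_distrib]
  refine Finset.prod_congr rfl fun i hi => ?_
  by_cases hJ : i ∈ J
  · simp [hJ, h' i hi hJ]
  · simp [hJ, h i hi hJ]

open Polynomial in
/-- Ruijsenaars' functional identity, in trigonometric form. -/
theorem sum_cutWeight_eq {ι K : Type*} [DecidableEq ι] [Field K] (q p u : K) (hqp : q * p ≠ 0)
    (hqp1 : (q * p) ^ 2 ≠ 1) (x : ι → K) (S : Finset ι) (hx0 : ∀ i ∈ S, x i ≠ 0)
    (hx : ∀ i ∈ S, ∀ j ∈ S, i ≠ j → ∀ k ≤ 2, x i ≠ (q * p) ^ k * x j) :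
    ∑ J ∈ S.powerset, u ^ J.card * cutWeight (fun i j => pairWeight q p (x i) (x j)) S J =
      ∑ J ∈ S.powerset, u ^ J.card * cutWeight (fun i j => pairWeight q p (x j) (x i)) S J := by
  induction S using Finset.strongInduction with
  | H S ih =>
  rcases S.eq_empty_or_nonempty with rfl | ⟨n, hnS⟩
  · simp [cutWeight]
  obtain ⟨T, hnT, rfl⟩ : ∃ T, n ∉ T ∧ S = insert n T :=
    ⟨S.erase n, by simp, (Finset.insert_erase hnS).symm⟩
  have hq : q ≠ 0 := left_ne_zero_of_mul hqp
  have hp : p ≠ 0 := right_ne_zero_of_mul hqp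
  have hTx0 : ∀ i ∈ T, x i ≠ 0 := fun i hi => hx0 i (Finset.mem_insert_of_mem hi)
  have hTx : ∀ i ∈ T, ∀ j ∈ T, i ≠ j → ∀ k ≤ 2, x i ≠ (q * p) ^ k * x j := fun i hi j hj =>
    hx i (Finset.mem_insert_of_mem hi) j (Finset.mem_insert_of_mem hj)
  set w : ι → ι → K := fun i j => pairWeight q p (x i) (x j) with hw
  set w' : ι → ι → K := fun i j => pairWeight q p (x j) (x i) with hw'
  let D : ι → K[X] := fun j => monicCubic (x j) (x j / (q * p)) (q * p * x j)
  let U : ι → K[X] := fun j => monicCubic (x j / q) (x j / p) (q * p * x j)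
  let V : ι → K[X] := fun j => monicCubic (q * x j) (p * x j) (x j / (q * p))
  have hDm : ∀ j, (D j).Monic ∧ (D j).natDegree = 3 := fun j => monicCubic_spec _ _ _
  have hUm : ∀ j, (U j).Monic ∧ (U j).natDegree = 3 := fun j => monicCubic_spec _ _ _
  have hVm : ∀ j, (V j).Monic ∧ (V j).natDegree = 3 := fun j => monicCubic_spec _ _ _
  let Q : (ι → K[X]) → (ι → K[X]) → Finset ι → Finset ι → K[X] := fun A B R J =>
    ∏ j ∈ R, if j ∈ J then A j else B j
  have hQm : ∀ A B : ι → K[X], (∀ j, (A j).Monic ∧ (A j).natDegree = 3) →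
      (∀ j, (B j).Monic ∧ (B j).natDegree = 3) → ∀ J,
      (Q A B T J).natDegree = 3 * T.card ∧ (Q A B T J).coeff (3 * T.card) = 1 := by
    intro A B hA hB J
    have h1 : ∀ j ∈ T, (if j ∈ J then A j else B j).Monic := by
      intro j _
      split_ifs
      exacts [(hA j).1, (hB j).1]
    have h2 : (Q A B T J).natDegree = 3 * T.card := by
      rw [natDegree_prod_of_monic _ _ h1, Finset.sum_congr rfl (g := fun _ => 3)]
      · simp [mul_comm]
      · intro j _
        split_ifs
        exacts [(hA j).2, (hB j).2]
    exact ⟨h2, by rw [← h2]; exact (monic_prod_of_monic _ _ h1).coeff_natDegree⟩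
  let N : K[X] := ∑ J ∈ T.powerset, (C (u ^ (J.card + 1) * cutWeight w T J) * Q D U T J +
    C (u ^ J.card * cutWeight w T J) * Q V D T J -
    C (u ^ (J.card + 1) * cutWeight w' T J) * Q D V T J -
    C (u ^ J.card * cutWeight w' T J) * Q U D T J)
  have hIH := ih T (Finset.ssubset_insert hnT) hTx0 hTx
  have hdeg : N.natDegree ≤ 3 * T.card := by
    refine natDegree_sum_le_of_forall_le _ _ fun J _ => ?_
    refine (natDegree_sub_le_iff_left ?_).2 ((natDegree_sub_le_iff_left ?_).2
      (natDegree_add_le_of_degree_le ?_ ?_))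
    · exact (natDegree_C_mul_le _ _).trans (hQm U D hUm hDm J).1.le
    · exact (natDegree_C_mul_le _ _).trans (hQm D V hDm hVm J).1.le
    · exact (natDegree_C_mul_le _ _).trans (hQm D U hDm hUm J).1.le
    · exact (natDegree_C_mul_le _ _).trans (hQm V D hVm hDm J).1.le
  have hlead : N.coeff (3 * T.card) = 0 := by
    have : N.coeff (3 * T.card) = (u + 1) * (∑ J ∈ T.powerset, u ^ J.card * cutWeight w T J -
        ∑ J ∈ T.powerset, u ^ J.card * cutWeight w' T J) := by
      simp only [N, finsetSum_coeff, coeff_add, coeff_sub, coeff_C_mul,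
        (hQm D U hDm hUm _).2, (hQm V D hVm hDm _).2, (hQm D V hDm hVm _).2,
        (hQm U D hUm hDm _).2]
      rw [← Finset.sum_sub_distrib, Finset.mul_sum]
      refine Finset.sum_congr rfl fun J _ => ?_
      ring
    rw [this, hIH, sub_self, mul_zero]
  have hDne : ∀ k z, (D k).eval z ≠ 0 ↔ z ≠ x k ∧ q * p * z ≠ x k ∧ z ≠ q * p * x k := by
    intro k z
    simp only [D, eval_monicCubic, mul_ne_zero_iff, sub_ne_zero, Ne, eq_div_iff hqp, and_assoc,
      mul_comm z]
  have hUe : ∀ k z, (D k).eval z ≠ 0 → (D k).eval z * pairWeight q p z (x k) = (U k).eval z := by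
    intro k z hz
    obtain ⟨h1, h2, h3⟩ := (hDne k z).1 hz
    rw [pairWeight, mul_div_assoc', div_eq_iff
      (mul_ne_zero (sub_ne_zero.2 h1.symm) (sub_ne_zero.2 h2.symm))]
    simp only [D, U, eval_monicCubic]
    field_simp
    ring
  have hVe : ∀ k z, (D k).eval z ≠ 0 → (D k).eval z * pairWeight q p (x k) z = (V k).eval z := by
    intro k z hz
    obtain ⟨h1, h2, h3⟩ := (hDne k z).1 hz
    rw [pairWeight, mul_div_assoc', div_eq_iff
      (mul_ne_zero (sub_ne_zero.2 h1) (sub_ne_zero.2 h3))]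
    simp only [D, V, eval_monicCubic]
    ring
  have hUV : ∀ k, (U k).eval (x k) + (V k).eval (x k) = 0 := by
    intro k
    simp only [U, V, eval_monicCubic]
    field_simp
    ring
  have hQe : ∀ A B R J z, (Q A B R J).eval z =
      ∏ j ∈ R, if j ∈ J then (A j).eval z else (B j).eval z := by
    intro A B R J z
    simp only [Q, eval_prod]
    refine Finset.prod_congr rfl fun j _ => ?_
    split_ifs <;> rfl
  have heval : ∀ j R, j ∉ R → T = insert j R → ∀ z, (D j).eval z = 0 → N.eval z =
      ∑ J ∈ R.powerset, u ^ (J.card + 1) * (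
        cutWeight w R J * (U j).eval z *
          ((∏ i ∈ R, if i ∈ J then w i j else 1) * (Q D U R J).eval z) +
        cutWeight w R J * (V j).eval z *
          ((∏ i ∈ R, if i ∈ J then 1 else w j i) * (Q V D R J).eval z) -
        cutWeight w' R J * (V j).eval z *
          ((∏ i ∈ R, if i ∈ J then w' i j else 1) * (Q D V R J).eval z) -
        cutWeight w' R J * (U j).eval z *
          ((∏ i ∈ R, if i ∈ J then 1 else w' j i) * (Q U D R J).eval z)) := by
    intro j R hj hT z hz
    simp only [N, hT]
    rw [Finset.sum_powerset_insert hj, eval_add, eval_finsetSum, eval_finsetSum,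
      ← Finset.sum_add_distrib]
    refine Finset.sum_congr rfl fun J hJ => ?_
    rw [Finset.mem_powerset] at hJ
    have hjJ : j ∉ J := fun h => hj (hJ h)
    have hQ1 : ∀ A B : ι → K[X], Q A B (insert j R) J = B j * Q A B R J := by
      intro A B
      simp [Q, Finset.prod_insert hj, hjJ]
    have hQ2 : ∀ A B : ι → K[X], Q A B (insert j R) (insert j J) = A j * Q A B R J := by
      intro A B
      simp only [Q, Finset.prod_insert hj, Finset.mem_insert_self, if_true]
      congr 1
      refine Finset.prod_congr rfl fun i hi => ?_
      have : i ≠ j := by rintro rfl; exact hj hi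
      simp [this]
    rw [Finset.card_insert_of_notMem hjJ]
    simp only [hQ1, hQ2, cutWeight_insert_left _ hj hJ, cutWeight_insert_right _ hj hJ,
      eval_add, eval_sub, eval_mul, eval_C, hz]
    ring
  have hDsep : ∀ j ∈ T, ∀ i ∈ T, i ≠ j → ∀ z, (D j).eval z = 0 → (D i).eval z ≠ 0 := by
    intro j hj i hi hij z hz
    have a0 := hTx i hi j hj hij 0 (by norm_num)
    have a1 := hTx i hi j hj hij 1 (by norm_num)
    have a2 := hTx i hi j hj hij 2 (by norm_num)
    have b1 := hTx j hj i hi hij.symm 1 (by norm_num)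
    have b2 := hTx j hj i hi hij.symm 2 (by norm_num)
    rw [hDne]
    simp only [D, eval_monicCubic, mul_eq_zero, sub_eq_zero] at hz
    rw [or_assoc] at hz
    rcases hz with rfl | rfl | rfl
    · exact ⟨fun h => a0 (by rw [h]; ring), fun h => a1 (by rw [← h]; ring),
        fun h => b1 (by rw [h]; ring)⟩
    · have e : x j = q * p * (x j / (q * p)) := (mul_div_cancel₀ _ hqp).symm
      refine ⟨fun h => b1 ?_, fun h => a0 ?_, fun h => b2 ?_⟩
      · rw [e, h]; ring
      · rw [← h, ← e]; ring
      · rw [e, h]; ring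
    · refine ⟨fun h => a1 (by rw [← h]; ring), fun h => a2 (by rw [← h]; ring),
        fun h => a0 ?_⟩
      rw [pow_zero, one_mul]
      exact (mul_left_cancel₀ hqp h).symm
  have hroot : ∀ j ∈ T, ∀ z, (D j).eval z = 0 → N.eval z = 0 := by
    intro j hjT z hz
    obtain ⟨R, hj, hT⟩ : ∃ R, j ∉ R ∧ T = insert j R :=
      ⟨T.erase j, by simp, (Finset.insert_erase hjT).symm⟩
    have hRT : ∀ i ∈ R, i ∈ T := fun i hi => hT ▸ Finset.mem_insert_of_mem hi
    have hRj : ∀ i ∈ R, i ≠ j := by rintro i hi rfl; exact hj hi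
    have hRIH := ih R ((Finset.ssubset_insert hj).trans (hT ▸ Finset.ssubset_insert hnT))
      (fun i hi => hTx0 i (hRT i hi)) (fun i hi k hk => hTx i (hRT i hi) k (hRT k hk))
    have hDz : ∀ i ∈ R, (D i).eval z ≠ 0 := fun i hi =>
      hDsep j hjT i (hRT i hi) (hRj i hi) z hz
    rw [heval j R hj hT z hz]
    simp only [hQe]
    simp only [D, eval_monicCubic, mul_eq_zero, sub_eq_zero] at hz
    rw [or_assoc] at hz
    rcases hz with hz | hz | hz
    · refine Finset.sum_eq_zero fun J _ => ?_
      rw [mul_eq_zero]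
      right
      have e := hUV j
      rw [← hz] at e
      have f1 : (∏ i ∈ R, if i ∈ J then w i j else 1) *
          (∏ i ∈ R, if i ∈ J then (D i).eval z else (U i).eval z) =
          (∏ i ∈ R, if i ∈ J then 1 else w j i) *
          (∏ i ∈ R, if i ∈ J then (V i).eval z else (D i).eval z) := by
        rw [← Finset.prod_mul_distrib, ← Finset.prod_mul_distrib]
        refine Finset.prod_congr rfl fun i hi => ?_
        by_cases h : i ∈ J
        · simp [h, hw, ← hz, ← hVe i z (hDz i hi), mul_comm]
        · simp [h, hw, ← hz, ← hUe i z (hDz i hi), mul_comm]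
      have f2 : (∏ i ∈ R, if i ∈ J then w' i j else 1) *
          (∏ i ∈ R, if i ∈ J then (D i).eval z else (V i).eval z) =
          (∏ i ∈ R, if i ∈ J then 1 else w' j i) *
          (∏ i ∈ R, if i ∈ J then (U i).eval z else (D i).eval z) := by
        rw [← Finset.prod_mul_distrib, ← Finset.prod_mul_distrib]
        refine Finset.prod_congr rfl fun i hi => ?_
        by_cases h : i ∈ J
        · simp [h, hw', ← hz, ← hUe i z (hDz i hi), mul_comm]
        · simp [h, hw', ← hz, ← hVe i z (hDz i hi), mul_comm]
      rw [f1, f2, eq_neg_of_add_eq_zero_left e]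
      ring
    · have e1 : ∀ J, (∏ i ∈ R, if i ∈ J then w i j else 1) *
          (∏ i ∈ R, if i ∈ J then (D i).eval z else (U i).eval z) = ∏ i ∈ R, (U i).eval z :=
        fun J => prod_ite_one_mul_prod_ite R J (fun i hi _ => by
          rw [← hUe i z (hDz i hi), hz, pairWeight_reflect_left hqp, mul_comm]) (fun _ _ _ => rfl)
      have e2 : ∀ J, (∏ i ∈ R, if i ∈ J then 1 else w' j i) *
          (∏ i ∈ R, if i ∈ J then (U i).eval z else (D i).eval z) = ∏ i ∈ R, (U i).eval z :=
        fun J => prod_ite_one_mul_prod_ite' R J (fun i hi _ => by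
          rw [← hUe i z (hDz i hi), hz, pairWeight_reflect_left hqp, mul_comm]) (fun _ _ _ => rfl)
      have e3 : (V j).eval z = 0 := by simp [V, eval_monicCubic, hz]
      simp only [e1, e2, e3]
      rw [← sub_eq_zero, ← Finset.sum_sub_distrib] at hRIH
      calc _ = (u * (U j).eval z * ∏ i ∈ R, (U i).eval z) * ∑ J ∈ R.powerset,
            (u ^ J.card * cutWeight w R J - u ^ J.card * cutWeight w' R J) := by
            rw [Finset.mul_sum]
            refine Finset.sum_congr rfl fun J _ => ?_
            ring
        _ = 0 := by rw [hRIH, mul_zero]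
    · have e1 : ∀ J, (∏ i ∈ R, if i ∈ J then 1 else w j i) *
          (∏ i ∈ R, if i ∈ J then (V i).eval z else (D i).eval z) = ∏ i ∈ R, (V i).eval z :=
        fun J => prod_ite_one_mul_prod_ite' R J (fun i hi _ => by
          rw [← hVe i z (hDz i hi), hz, pairWeight_reflect_right hqp, mul_comm]) (fun _ _ _ => rfl)
      have e2 : ∀ J, (∏ i ∈ R, if i ∈ J then w' i j else 1) *
          (∏ i ∈ R, if i ∈ J then (D i).eval z else (V i).eval z) = ∏ i ∈ R, (V i).eval z :=
        fun J => prod_ite_one_mul_prod_ite R J (fun i hi _ => by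
          rw [← hVe i z (hDz i hi), hz, pairWeight_reflect_right hqp, mul_comm]) (fun _ _ _ => rfl)
      have e3 : (U j).eval z = 0 := by simp [U, eval_monicCubic, hz]
      simp only [e1, e2, e3]
      rw [← sub_eq_zero, ← Finset.sum_sub_distrib] at hRIH
      calc _ = (u * (V j).eval z * ∏ i ∈ R, (V i).eval z) * ∑ J ∈ R.powerset,
            (u ^ J.card * cutWeight w R J - u ^ J.card * cutWeight w' R J) := by
            rw [Finset.mul_sum]
            refine Finset.sum_congr rfl fun J _ => ?_
            ring
        _ = 0 := by rw [hRIH, mul_zero]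
  have hN : N = 0 := by
    by_contra hN0
    have hlt : N.natDegree < 3 * T.card := by
      refine lt_of_le_of_ne hdeg fun h => hN0 ?_
      rw [← leadingCoeff_eq_zero, leadingCoeff, h, hlead]
    have hp0 : (∏ j ∈ T, D j).natDegree = 3 * T.card := by
      rw [natDegree_prod_of_monic _ _ fun j _ => (hDm j).1, Finset.sum_congr rfl fun j _ => (hDm j).2]
      simp [mul_comm]
    have hdvd : (∏ j ∈ T, D j) ∣ N := by
      have hcop : ∀ a b : K, a ≠ b → IsCoprime (X - C a) (X - C b) := fun a b h =>
        isCoprime_X_sub_C_of_isUnit_sub (sub_ne_zero.2 h).isUnit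
      have hr : ∀ j ∈ T, ∀ a, (D j).eval a = 0 → X - C a ∣ N := fun j hj a ha =>
        dvd_iff_isRoot.2 (hroot j hj a ha)
      refine Finset.prod_dvd_of_coprime ?_ ?_
      · intro i hi j hj hij
        have hc : ∀ a, (D i).eval a = 0 → IsCoprime (X - C a) (D j) := by
          intro a ha
          have h := hDsep i hi j hj hij.symm a ha
          simp only [D, eval_monicCubic, mul_ne_zero_iff, sub_ne_zero] at h
          exact ((hcop _ _ h.1.1).mul_right (hcop _ _ h.1.2)).mul_right (hcop _ _ h.2)
        refine IsCoprime.mul_left (IsCoprime.mul_left (hc _ ?_) (hc _ ?_)) (hc _ ?_) <;>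
          simp [D, eval_monicCubic]
      · intro j hj
        have h0 := hTx0 j hj
        have g1 : x j ≠ x j / (q * p) := fun h => hqp1 (by
          rw [eq_div_iff hqp, mul_eq_left₀ h0] at h
          rw [h, one_pow])
        have g2 : x j ≠ q * p * x j := fun h => hqp1 (by
          rw [eq_comm, mul_eq_right₀ h0] at h
          rw [h, one_pow])
        have g3 : x j / (q * p) ≠ q * p * x j := fun h => hqp1 (by
          rw [div_eq_iff hqp] at h
          exact mul_right_cancel₀ h0 (by linear_combination -h))
        refine IsCoprime.mul_dvd (IsCoprime.mul_left (hcop _ _ g2) (hcop _ _ g3))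
          (IsCoprime.mul_dvd (hcop _ _ g1) ?_ ?_) ?_ <;> refine hr j hj _ ?_ <;>
          simp [D, eval_monicCubic]
    exact absurd (natDegree_le_of_dvd hdvd hN0) (by omega)
  have hDn : ∀ i ∈ T, (D i).eval (x n) ≠ 0 := by
    intro i hi
    have hi' : i ∈ insert n T := Finset.mem_insert_of_mem hi
    have hn' : n ∈ insert n T := Finset.mem_insert_self _ _
    have hin : i ≠ n := by rintro rfl; exact hnT hi
    have a0 := hx i hi' n hn' hin 0 (by norm_num)
    have a1 := hx i hi' n hn' hin 1 (by norm_num)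
    have b1 := hx n hn' i hi' hin.symm 1 (by norm_num)
    rw [hDne]
    exact ⟨fun h => a0 (by rw [h]; ring), fun h => a1 (by rw [← h]; ring),
      fun h => b1 (by rw [h]; ring)⟩
  have hfin : N.eval (x n) = (∏ i ∈ T, (D i).eval (x n)) *
      (∑ J ∈ (insert n T).powerset, u ^ J.card * cutWeight w (insert n T) J -
        ∑ J ∈ (insert n T).powerset, u ^ J.card * cutWeight w' (insert n T) J) := by
    rw [Finset.sum_powerset_insert hnT, Finset.sum_powerset_insert hnT, ← Finset.sum_add_distrib,
      ← Finset.sum_add_distrib, ← Finset.sum_sub_distrib, Finset.mul_sum]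
    simp only [N, eval_finsetSum]
    refine Finset.sum_congr rfl fun J hJ => ?_
    rw [Finset.mem_powerset] at hJ
    have hnJ : n ∉ J := fun h => hnT (hJ h)
    rw [Finset.card_insert_of_notMem hnJ]
    have e1 : (Q D U T J).eval (x n) = (∏ i ∈ T, (D i).eval (x n)) *
        ∏ i ∈ T, if i ∈ J then 1 else w n i := by
      rw [hQe, ← Finset.prod_mul_distrib]
      refine Finset.prod_congr rfl fun i hi => ?_
      split_ifs
      exacts [(mul_one _).symm, (hUe i _ (hDn i hi)).symm]
    have e2 : (Q V D T J).eval (x n) = (∏ i ∈ T, (D i).eval (x n)) *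
        ∏ i ∈ T, if i ∈ J then w i n else 1 := by
      rw [hQe, ← Finset.prod_mul_distrib]
      refine Finset.prod_congr rfl fun i hi => ?_
      split_ifs
      exacts [(hVe i _ (hDn i hi)).symm, (mul_one _).symm]
    have e3 : (Q D V T J).eval (x n) = (∏ i ∈ T, (D i).eval (x n)) *
        ∏ i ∈ T, if i ∈ J then 1 else w' n i := by
      rw [hQe, ← Finset.prod_mul_distrib]
      refine Finset.prod_congr rfl fun i hi => ?_
      split_ifs
      exacts [(mul_one _).symm, (hVe i _ (hDn i hi)).symm]
    have e4 : (Q U D T J).eval (x n) = (∏ i ∈ T, (D i).eval (x n)) *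
        ∏ i ∈ T, if i ∈ J then w' i n else 1 := by
      rw [hQe, ← Finset.prod_mul_distrib]
      refine Finset.prod_congr rfl fun i hi => ?_
      split_ifs
      exacts [(hUe i _ (hDn i hi)).symm, (mul_one _).symm]
    simp only [cutWeight_insert_left _ hnT hJ, cutWeight_insert_right _ hnT hJ,
      eval_add, eval_sub, eval_mul, eval_C, e1, e2, e3, e4]
    ring
  rw [hN, eval_zero, zero_eq_mul, sub_eq_zero] at hfin
  exact hfin.resolve_left (Finset.prod_ne_zero_iff.2 hDn)

theorem prod_Ico_prod_Ico_telescope {K : Type*} [Field K] (h : ℕ → K) (hh : ∀ n, h n ≠ 0)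
    {A V V' B : ℕ} (hAV : A ≤ V) (hV : V ≤ V') (hB : V' ≤ B) :
    ∏ k ∈ Finset.Ico A V, ∏ l ∈ Finset.Ico V' B,
      h (l - k) * h (l - k) / (h (l - k - 1) * h (l - k + 1)) =
    h (B - V) * h (V' - A) / (h (B - A) * h (V' - V)) := by
  have inner : ∀ k < V', ∏ l ∈ Finset.Ico V' B,
      h (l - k) * h (l - k) / (h (l - k - 1) * h (l - k + 1)) =
      h (B - (k + 1)) * h (V' - k) / (h (B - k) * h (V' - (k + 1))) := by
    intro k hk
    induction B, hB using Nat.le_induction with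
    | base =>
      have := hh (V' - k)
      have := hh (V' - (k + 1))
      simp only [Finset.Ico_self, Finset.prod_empty]
      field_simp
    | succ B hB ih =>
      rw [Finset.prod_Ico_succ_top hB, ih]
      have e1 : B + 1 - (k + 1) = B - k := by omega
      have e2 : B - k - 1 = B - (k + 1) := by omega
      have e3 : B - k + 1 = B + 1 - k := by omega
      rw [e1, e2, e3]
      have := hh (B - k)
      have := hh (B - (k + 1))
      have := hh (B + 1 - k)
      have := hh (V' - (k + 1))
      field_simp
  induction V, hAV using Nat.le_induction with
  | base =>
    have := hh (V' - A)
    have := hh (B - A)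
    simp only [Finset.Ico_self, Finset.prod_empty]
    field_simp
  | succ V hAV ih =>
    rw [Finset.prod_Ico_succ_top hAV, ih (by omega), inner V (by omega)]
    have := hh (B - V)
    have := hh (B - A)
    have := hh (B - (V + 1))
    have := hh (V' - V)
    have := hh (V' - (V + 1))
    field_simp

/-- The triangular product of `g (f i - h j) (j - i)` over `i ≤ j < N`. -/
def triProd {K : Type*} [CommMonoid K] (g : ℕ → ℕ → K) (N : ℕ) (f h : ℕ → ℕ) : K :=
  ∏ i ∈ Finset.range N, ∏ j ∈ Finset.range N, if i ≤ j then g (f i - h j) (j - i) else 1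

/-- The shift of a sequence. -/
def shiftSeq (f : ℕ → ℕ) : ℕ → ℕ := fun j => f (j + 1)

theorem triProd_ne_zero {K : Type*} [Field K] {g : ℕ → ℕ → K} (hg : ∀ n m, g n m ≠ 0) (N : ℕ)
    (f h : ℕ → ℕ) : triProd g N f h ≠ 0 := by
  refine Finset.prod_ne_zero_iff.2 fun i _ => Finset.prod_ne_zero_iff.2 fun j _ => ?_
  split_ifs
  exacts [hg _ _, one_ne_zero]

theorem triProd_succ_right {K : Type*} [CommMonoid K] (g : ℕ → ℕ → K) (N : ℕ) (f h : ℕ → ℕ) :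
    triProd g (N + 1) f h =
      triProd g N f h * ∏ i ∈ Finset.range (N + 1), g (f i - h N) (N - i) := by
  unfold triProd
  rw [Finset.prod_range_succ, Finset.prod_range_succ (fun i => g (f i - h N) (N - i)),
    ← mul_assoc, ← Finset.prod_mul_distrib]
  congr 1
  · refine Finset.prod_congr rfl fun i hi => ?_
    rw [Finset.prod_range_succ, if_pos (Finset.mem_range.1 hi).le]
  · rw [Finset.prod_range_succ, if_pos le_rfl]
    rw [Finset.prod_eq_one, one_mul]
    intro j hj
    rw [if_neg (by have := Finset.mem_range.1 hj; omega)]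

theorem triProd_succ_left {K : Type*} [CommMonoid K] (g : ℕ → ℕ → K) (N : ℕ) (f h : ℕ → ℕ) :
    triProd g (N + 1) f h =
      (∏ j ∈ Finset.range (N + 1), g (f 0 - h j) j) * triProd g N (shiftSeq f) (shiftSeq h) := by
  unfold triProd
  rw [Finset.prod_range_succ', mul_comm]
  congr 1
  refine Finset.prod_congr rfl fun i _ => ?_
  rw [Finset.prod_range_succ']
  simp [shiftSeq]

theorem prod_prod_lt_eq_triProd {K : Type*} [CommMonoid K] (g : ℕ → ℕ → K) (N : ℕ)
    (f h : ℕ → ℕ) :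
    (∏ i ∈ Finset.range (N + 1), ∏ j ∈ Finset.range (N + 1),
      if i < j then g (f i - h j) (j - i - 1) else 1) = triProd g N f (shiftSeq h) := by
  unfold triProd
  rw [Finset.prod_range_succ, Finset.prod_eq_one (s := Finset.range (N + 1)), mul_one]
  · refine Finset.prod_congr rfl fun i _ => ?_
    rw [Finset.prod_range_succ', if_neg (by omega), mul_one]
    refine Finset.prod_congr rfl fun j _ => ?_
    simp only [shiftSeq, Nat.lt_succ_iff]
    split_ifs with h1
    · congr 1
      omega
    · rfl
  · intro j hj
    rw [if_neg (by have := Finset.mem_range.1 hj; omega)]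

/-- The cells `⟨j, k⟩` with `j < n` and `a j ≤ k < b j`. -/
def stringCells (n : ℕ) (a b : ℕ → ℕ) : Finset (Σ _ : ℕ, ℕ) :=
  (Finset.range n).sigma fun j => Finset.Ico (a j) (b j)

theorem cutWeight_stringCells {K : Type*} [Field K] {g : ℕ → ℕ → K} (hg : ∀ n m, g n m ≠ 0)
    (w : (Σ _ : ℕ, ℕ) → (Σ _ : ℕ, ℕ) → K)
    (hw1 : ∀ i j k l, i ≤ j → k < l → w ⟨j, k⟩ ⟨i, l⟩ =
      g (l - k) (j - i) * g (l - k) (j - i) / (g (l - k - 1) (j - i) * g (l - k + 1) (j - i)))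
    (hw2 : ∀ i j k l, i < j → l < k → w ⟨i, k⟩ ⟨j, l⟩ =
      g (k - l) (j - i - 1) * g (k - l) (j - i - 1) /
        (g (k - l - 1) (j - i - 1) * g (k - l + 1) (j - i - 1)))
    (N : ℕ) {a b v : ℕ → ℕ} (hav : ∀ j, a j ≤ v j) (hvb : ∀ j, v j ≤ b j)
    (hba : ∀ j, b (j + 1) ≤ a j) :
    cutWeight w (stringCells (N + 1) a b) (stringCells (N + 1) a v) =
      triProd g (N + 1) v a * triProd g (N + 1) b v /
        (triProd g (N + 1) v v * triProd g (N + 1) b a) *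
      (triProd g N a (shiftSeq v) * triProd g N v (shiftSeq b) /
        (triProd g N a (shiftSeq b) * triProd g N v (shiftSeq v))) := by
  have hanti : ∀ i j, i < j → b j ≤ a i := by
    intro i j hij
    induction j, hij using Nat.le_induction with
    | base => exact hba i
    | succ j hj ih => exact (hba j).trans (((hav j).trans (hvb j)).trans ih)
  have hblock : cutWeight w (stringCells (N + 1) a b) (stringCells (N + 1) a v) =
      ∏ j ∈ Finset.range (N + 1), ∏ i ∈ Finset.range (N + 1),
        ∏ k ∈ Finset.Ico (a j) (v j), ∏ l ∈ Finset.Ico (v i) (b i), w ⟨j, k⟩ ⟨i, l⟩ := by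
    unfold cutWeight stringCells
    rw [Finset.prod_sigma]
    refine Finset.prod_congr rfl fun j hj => ?_
    simp_rw [Finset.prod_sigma]
    rw [Finset.prod_comm]
    refine Finset.prod_congr rfl fun i hi => ?_
    rw [← Finset.prod_Ico_consecutive _ (hav j) (hvb j),
      Finset.prod_eq_one (s := Finset.Ico (v j) (b j)), mul_one]
    · refine Finset.prod_congr rfl fun k hk => ?_
      rw [← Finset.prod_Ico_consecutive _ (hav i) (hvb i),
        Finset.prod_eq_one (s := Finset.Ico (a i) (v i)), one_mul]
      · refine Finset.prod_congr rfl fun l hl => ?_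
        rw [if_pos]
        simp only [Finset.mem_sigma, hj, hi, true_and, hk]
        rw [Finset.mem_Ico] at hl ⊢
        omega
      · intro l hl
        rw [if_neg]
        simp only [Finset.mem_sigma, hi, hl, and_self, not_true_eq_false, and_false,
          not_false_eq_true]
    · intro k hk
      refine Finset.prod_eq_one fun l _ => ?_
      rw [if_neg]
      simp only [Finset.mem_sigma, hj, true_and]
      rw [Finset.mem_Ico] at hk ⊢
      omega
  have hterm : ∀ j ∈ Finset.range (N + 1), ∀ i ∈ Finset.range (N + 1),
      ∏ k ∈ Finset.Ico (a j) (v j), ∏ l ∈ Finset.Ico (v i) (b i), w ⟨j, k⟩ ⟨i, l⟩ =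
      (if i ≤ j then g (v i - a j) (j - i) else 1) * (if i ≤ j then g (b i - v j) (j - i) else 1) /
        ((if i ≤ j then g (v i - v j) (j - i) else 1) *
          (if i ≤ j then g (b i - a j) (j - i) else 1)) *
      ((if j < i then g (a j - v i) (i - j - 1) else 1) *
        (if j < i then g (v j - b i) (i - j - 1) else 1) /
        ((if j < i then g (a j - b i) (i - j - 1) else 1) *
          (if j < i then g (v j - v i) (i - j - 1) else 1))) := by
    intro j _ i _
    by_cases hij : i ≤ j
    · have hv : v j ≤ v i := by
        rcases hij.eq_or_lt with rfl | h
        · exact le_rfl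
        · exact (hvb j).trans ((hanti i j h).trans (hav i))
      simp only [if_pos hij, if_neg (not_lt.2 hij), mul_one, div_one]
      rw [mul_comm (g (v i - a j) _), mul_comm (g (v i - v j) _),
        ← prod_Ico_prod_Ico_telescope (fun d => g d (j - i)) (fun d => hg d _) (hav j) hv (hvb i)]
      refine Finset.prod_congr rfl fun k hk => Finset.prod_congr rfl fun l hl => ?_
      rw [Finset.mem_Ico] at hk hl
      exact hw1 _ _ _ _ hij (by omega)
    · have hij' : j < i := not_le.1 hij
      simp only [if_neg hij, if_pos hij', mul_one, div_one, one_mul]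
      rw [mul_comm (g (a j - v i) _), mul_comm (g (a j - b i) _), Finset.prod_comm,
        ← prod_Ico_prod_Ico_telescope (fun d => g d (i - j - 1)) (fun d => hg d _) (hvb i)
          (hanti j i hij') (hav j)]
      refine Finset.prod_congr rfl fun l hl => Finset.prod_congr rfl fun k hk => ?_
      rw [Finset.mem_Ico] at hk hl
      have := hanti j i hij'
      exact hw2 _ _ _ _ hij' (by omega)
  have hc : ∀ f h : ℕ → ℕ, (∏ j ∈ Finset.range (N + 1), ∏ i ∈ Finset.range (N + 1),
      if i ≤ j then g (f i - h j) (j - i) else 1) = triProd g (N + 1) f h :=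
    fun f h => Finset.prod_comm
  rw [hblock, Finset.prod_congr rfl fun j hj => Finset.prod_congr rfl fun i hi => hterm j hj i hi]
  simp only [Finset.prod_mul_distrib, Finset.prod_div_distrib, hc, prod_prod_lt_eq_triProd]

theorem exists_stringCells_eq {K : Type*} [CommMonoidWithZero K] [NoZeroDivisors K] [Nontrivial K]
    (w : (Σ _ : ℕ, ℕ) → (Σ _ : ℕ, ℕ) → K)
    (hw0 : ∀ j k, w ⟨j, k + 1⟩ ⟨j, k⟩ = 0) (n : ℕ) {a b : ℕ → ℕ} (hab : ∀ j, a j ≤ b j)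
    {J : Finset (Σ _ : ℕ, ℕ)} (hJ : J ⊆ stringCells n a b)
    (hc : cutWeight w (stringCells n a b) J ≠ 0) :
    ∃ v ∈ (Finset.range n).finsupp (fun j => Finset.Icc (a j) (b j)), stringCells n a v = J := by
  have hdown : ∀ j k, a j ≤ k → (⟨j, k + 1⟩ : Σ _ : ℕ, ℕ) ∈ J → (⟨j, k⟩ : Σ _ : ℕ, ℕ) ∈ J := by
    intro j k hk h
    by_contra h'
    refine hc ?_
    have h1 := hJ h
    refine Finset.prod_eq_zero h1 (Finset.prod_eq_zero (i := ⟨j, k⟩) ?_ ?_)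
    · simp only [stringCells, Finset.mem_sigma, Finset.mem_range, Finset.mem_Ico] at h1 ⊢
      omega
    · rw [if_pos ⟨h, h'⟩, hw0]
  have hdown' : ∀ j k d, a j ≤ k → (⟨j, k + d⟩ : Σ _ : ℕ, ℕ) ∈ J → (⟨j, k⟩ : Σ _ : ℕ, ℕ) ∈ J := by
    intro j k d hk
    induction d with
    | zero => exact id
    | succ d ih => exact fun h => ih (hdown j (k + d) (by omega) h)
  let E : ℕ → ℕ := fun j => max (a j)
    (((Finset.Ico (a j) (b j)).filter fun k => (⟨j, k⟩ : Σ _ : ℕ, ℕ) ∈ J).sup (· + 1))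
  let v : ℕ →₀ ℕ := Finsupp.onFinset (Finset.range n) (fun j => if j < n then E j else 0) (by
    intro j hj
    by_contra h
    exact hj (if_neg (by simpa using h)))
  have hv : ∀ j < n, v j = E j := fun j hj => if_pos hj
  refine ⟨v, ?_, ?_⟩
  · rw [Finset.mem_finsupp_iff]
    refine ⟨Finsupp.support_onFinset_subset, fun j hj => ?_⟩
    rw [hv j (Finset.mem_range.1 hj), Finset.mem_Icc]
    refine ⟨le_max_left _ _, max_le (hab j) (Finset.sup_le fun k hk => ?_)⟩
    simp only [Finset.mem_filter, Finset.mem_Ico] at hk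
    omega
  · ext ⟨j, k⟩
    simp only [stringCells, Finset.mem_sigma, Finset.mem_range, Finset.mem_Ico]
    constructor
    · rintro ⟨hj, hk, hk'⟩
      rw [hv j hj, lt_max_iff, or_iff_right (by omega), Finset.lt_sup_iff] at hk'
      obtain ⟨l, hl, hkl⟩ := hk'
      refine hdown' j k (l - k) hk ?_
      rw [Nat.add_sub_cancel' (by omega)]
      exact (Finset.mem_filter.1 hl).2
    · intro h
      have h1 := hJ h
      simp only [stringCells, Finset.mem_sigma, Finset.mem_range, Finset.mem_Ico] at h1
      refine ⟨h1.1, h1.2.1, ?_⟩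
      rw [hv j h1.1, lt_max_iff]
      right
      rw [Finset.lt_sup_iff]
      exact ⟨k, by simp [h, h1], by omega⟩

theorem stringCells_injOn (n : ℕ) (a b : ℕ → ℕ) :
    Set.InjOn (fun v : ℕ →₀ ℕ => stringCells n a v)
      ((Finset.range n).finsupp fun j => Finset.Icc (a j) (b j)) := by
  intro v hv v' hv' h
  rw [Finset.mem_coe, Finset.mem_finsupp_iff] at hv hv'
  ext j
  by_cases hj : j ∈ Finset.range n
  · have h1 := Finset.mem_Icc.1 (hv.2 j hj)
    have h2 := Finset.mem_Icc.1 (hv'.2 j hj)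
    have hk : ∀ k, k ∈ Finset.Ico (a j) (v j) ↔ k ∈ Finset.Ico (a j) (v' j) := by
      intro k
      have := Finset.ext_iff.1 h ⟨j, k⟩
      simpa only [stringCells, Finset.mem_sigma, hj, true_and] using this
    have e : Finset.Ico (a j) (v j) = Finset.Ico (a j) (v' j) := Finset.ext hk
    have := congrArg Finset.card e
    simp only [Nat.card_Ico] at this
    omega
  · rw [Finsupp.notMem_support_iff.1 fun h => hj (hv.1 h),
      Finsupp.notMem_support_iff.1 fun h => hj (hv'.1 h)]

theorem cutWeight_swap {ι K : Type*} [DecidableEq ι] [CommMonoid K] (w : ι → ι → K)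
    (S J : Finset ι) :
    cutWeight (fun i j => w j i) S J = cutWeight w S (S \ J) := by
  unfold cutWeight
  rw [Finset.prod_comm]
  refine Finset.prod_congr rfl fun i hi => Finset.prod_congr rfl fun j hj => ?_
  simp only [Finset.mem_sdiff, hi, hj, true_and, not_not, and_comm]

/-- Finite-string identity: comparison of coefficients of the cut weight generating function. -/
theorem sum_stringCells_eq {K : Type*} [Field K] [Infinite K]
    (w : (Σ _ : ℕ, ℕ) → (Σ _ : ℕ, ℕ) → K)
    (hw0 : ∀ j k, w ⟨j, k + 1⟩ ⟨j, k⟩ = 0) (n : ℕ) {a b : ℕ → ℕ} (hab : ∀ j, a j ≤ b j)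
    (hsum : ∀ u : K, ∑ J ∈ (stringCells n a b).powerset,
        u ^ J.card * cutWeight w (stringCells n a b) J =
      ∑ J ∈ (stringCells n a b).powerset,
        u ^ J.card * cutWeight (fun i j => w j i) (stringCells n a b) J) (R : ℕ) :
    ∑ v ∈ ((Finset.range n).finsupp fun j => Finset.Icc (a j) (b j)) with
        ∑ j ∈ Finset.range n, (v j - a j) = R,
      cutWeight w (stringCells n a b) (stringCells n a v) =
    ∑ v ∈ ((Finset.range n).finsupp fun j => Finset.Icc (a j) (b j)) with
        ∑ j ∈ Finset.range n, (b j - v j) = R,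
      cutWeight w (stringCells n a b) (stringCells n a v) := by
  set S := stringCells n a b with hS
  have hsub : ∀ v ∈ (Finset.range n).finsupp (fun j => Finset.Icc (a j) (b j)),
      stringCells n a v ⊆ S := by
    intro v hv
    rw [Finset.mem_finsupp_iff] at hv
    refine Finset.sigma_mono le_rfl fun j k hk => ?_
    rw [Finset.mem_Ico] at hk ⊢
    by_cases hj : j ∈ Finset.range n
    · have := Finset.mem_Icc.1 (hv.2 j hj)
      omega
    · rw [Finsupp.notMem_support_iff.1 fun h => hj (hv.1 h)] at hk
      omega
  have key : ∀ R' : ℕ, ∀ f : Finset (Σ _ : ℕ, ℕ) → ℕ,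
      ∑ J ∈ S.powerset with f J = R', cutWeight w S J =
      ∑ v ∈ (Finset.range n).finsupp (fun j => Finset.Icc (a j) (b j)) with
        f (stringCells n a (v : ℕ →₀ ℕ)) = R', cutWeight w S (stringCells n a v) := by
    intro R' f
    symm
    refine Finset.sum_of_injOn (fun v : ℕ →₀ ℕ => stringCells n a v)
      ((stringCells_injOn n a b).mono fun v hv => (Finset.mem_filter.1 hv).1) ?_ ?_ fun _ _ => rfl
    · intro v hv
      rw [Finset.mem_coe, Finset.mem_filter] at hv ⊢
      exact ⟨Finset.mem_powerset.2 (hsub v hv.1), hv.2⟩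
    · intro J hJ hJ'
      rw [Finset.mem_filter, Finset.mem_powerset] at hJ
      by_contra h0
      obtain ⟨v, hv, rfl⟩ := exists_stringCells_eq w hw0 n hab hJ.1 h0
      exact hJ' ⟨v, Finset.mem_coe.2 (Finset.mem_filter.2 ⟨hv, hJ.2⟩), rfl⟩
  have hcoeff : ∀ c : Finset (Σ _ : ℕ, ℕ) → K,
      (∑ J ∈ S.powerset, Polynomial.C (c J) * Polynomial.X ^ J.card).coeff R =
        ∑ J ∈ S.powerset with J.card = R, c J := by
    intro c
    rw [Polynomial.finsetSum_coeff, Finset.sum_filter]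
    refine Finset.sum_congr rfl fun J _ => ?_
    rw [Polynomial.coeff_C_mul_X_pow]
    exact if_congr eq_comm rfl rfl
  have hpoly : (∑ J ∈ S.powerset, Polynomial.C (cutWeight w S J) * Polynomial.X ^ J.card) =
      ∑ J ∈ S.powerset,
        Polynomial.C (cutWeight (fun i j => w j i) S J) * Polynomial.X ^ J.card := by
    refine Polynomial.funext fun u => ?_
    simp only [Polynomial.eval_finsetSum, Polynomial.eval_mul, Polynomial.eval_C,
      Polynomial.eval_pow, Polynomial.eval_X, mul_comm (cutWeight _ _ _)]
    exact hsum u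
  have h1 := congrArg (fun p => Polynomial.coeff p R) hpoly
  simp only [hcoeff] at h1
  have h2 : ∑ J ∈ S.powerset with J.card = R, cutWeight (fun i j => w j i) S J =
      ∑ J ∈ S.powerset with (S \ J).card = R, cutWeight w S J := by
    refine Finset.sum_nbij' (fun J => S \ J) (fun J => S \ J) ?_ ?_ ?_ ?_ ?_
    · intro J hJ
      rw [Finset.mem_filter, Finset.mem_powerset] at hJ ⊢
      exact ⟨Finset.sdiff_subset, by rw [Finset.sdiff_sdiff_eq_self hJ.1, hJ.2]⟩
    · intro J hJ
      rw [Finset.mem_filter, Finset.mem_powerset] at hJ ⊢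
      exact ⟨Finset.sdiff_subset, hJ.2⟩
    · intro J hJ
      rw [Finset.mem_filter, Finset.mem_powerset] at hJ
      exact Finset.sdiff_sdiff_eq_self hJ.1
    · intro J hJ
      rw [Finset.mem_filter, Finset.mem_powerset] at hJ
      exact Finset.sdiff_sdiff_eq_self hJ.1
    · intro J hJ
      exact cutWeight_swap w S J
  rw [h2, key R Finset.card, key R fun J => (S \ J).card] at h1
  have hcard : ∀ c d : ℕ → ℕ, (stringCells n c d).card =
      ∑ j ∈ Finset.range n, (d j - c j) := by
    intro c d
    simp [stringCells]
  refine Eq.trans ?_ (h1.trans ?_)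
  · simp only [hcard]
  · refine Finset.sum_congr (Finset.filter_congr fun v hv => ?_) fun _ _ => rfl
    rw [Finset.card_sdiff_of_subset (hsub v hv), hS, hcard, hcard]
    rw [Finset.mem_finsupp_iff] at hv
    have : ∑ j ∈ Finset.range n, (b j - a j) = ∑ j ∈ Finset.range n, (v j - a j) +
        ∑ j ∈ Finset.range n, (b j - v j) := by
      rw [← Finset.sum_add_distrib]
      refine Finset.sum_congr rfl fun j hj => ?_
      have := Finset.mem_Icc.1 (hv.2 j hj)
      omega
    rw [this, Nat.add_sub_cancel_left]

/-- Prepend an entry to a sequence. -/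
def consSeq (k : ℕ) (f : ℕ → ℕ) : ℕ → ℕ
  | 0 => k
  | j + 1 => f j

/-- Prepend an entry to a finitely supported sequence. -/
noncomputable def consFinsupp (k : ℕ) (f : ℕ →₀ ℕ) : ℕ →₀ ℕ :=
  Finsupp.onFinset (Finset.range (f.support.sup id + 2)) (consSeq k f) (by
    intro j hj
    rcases j with _ | j
    · simp
    · have : j ≤ f.support.sup id := Finset.le_sup (f := id) (Finsupp.mem_support_iff.2 hj)
      rw [Finset.mem_range]
      omega)

theorem coe_consFinsupp (k : ℕ) (f : ℕ →₀ ℕ) : ⇑(consFinsupp k f) = consSeq k f := rfl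

theorem tendsto_ratio {g : ℕ → ℕ → ℝ} (hg : ∀ n m, g n m ≠ 0)
    (hlim : ∀ m, Filter.Tendsto (fun n => g (n + 1) m / g n m) Filter.atTop (nhds 1))
    (a c m : ℕ) :
    Filter.Tendsto (fun M => g (M - a) m / g (M - c) m) Filter.atTop (nhds 1) := by
  have h1 : ∀ d, Filter.Tendsto (fun n => g (n + d) m / g n m) Filter.atTop (nhds 1) := by
    intro d
    induction d with
    | zero => simp [hg]
    | succ d ih =>
      have := ((hlim m).comp (Filter.tendsto_add_atTop_nat d)).mul ih
      rw [one_mul] at this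
      refine this.congr fun n => ?_
      have := hg (n + d) m
      have := hg n m
      simp only [Function.comp_apply, ← add_assoc]
      field_simp
  have h2 : ∀ d, Filter.Tendsto (fun M => g M m / g (M - d) m) Filter.atTop (nhds 1) := by
    intro d
    refine ((h1 d).comp (Filter.tendsto_sub_atTop_nat d)).congr' ?_
    filter_upwards [Filter.eventually_ge_atTop d] with M hM
    simp only [Function.comp_apply, Nat.sub_add_cancel hM]
  have := (h2 c).div (h2 a) one_ne_zero
  rw [div_one] at this
  refine this.congr fun M => ?_
  have := hg M m
  have := hg (M - a) m
  have := hg (M - c) m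
  simp only [Pi.div_apply]
  field_simp

/-- The weight of a finite string configuration `v`. -/
noncomputable def stringWeight (g : ℕ → ℕ → ℝ) (N : ℕ) (a b v : ℕ → ℕ) : ℝ :=
  triProd g (N + 1) v a * triProd g (N + 1) b v /
    (triProd g (N + 1) v v * triProd g (N + 1) b a) *
  (triProd g N a (shiftSeq v) * triProd g N v (shiftSeq b) /
    (triProd g N a (shiftSeq b) * triProd g N v (shiftSeq v)))

/-- The upper weight of `ν` relative to a pair of sequences. -/
noncomputable def upperWeight (g : ℕ → ℕ → ℝ) (N : ℕ) (α β ν : ℕ → ℕ) : ℝ :=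
  triProd g N ν α * triProd g N ν β * triProd g N α (shiftSeq ν) * triProd g N β (shiftSeq ν) /
    (triProd g N ν ν * triProd g N ν (shiftSeq ν))

/-- The lower weight of `κ` relative to a pair of sequences. -/
noncomputable def lowerWeight (g : ℕ → ℕ → ℝ) (N : ℕ) (α β κ : ℕ → ℕ) : ℝ :=
  triProd g N α κ * triProd g N β κ * triProd g N κ (shiftSeq α) * triProd g N κ (shiftSeq β) /
    (triProd g N κ κ * triProd g N κ (shiftSeq κ))

theorem tendsto_stringWeight_upper {g : ℕ → ℕ → ℝ} (hg : ∀ n m, g n m ≠ 0)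
    (hlim : ∀ m, Filter.Tendsto (fun n => g (n + 1) m / g n m) Filter.atTop (nhds 1))
    (N : ℕ) {α β ν : ℕ → ℕ} (hα : α N = 0) (hν : ν N = 0) :
    Filter.Tendsto (fun M => stringWeight g N α (consSeq M β) ν) Filter.atTop
      (nhds (upperWeight g N α β ν /
        (triProd g N β (shiftSeq α) * triProd g N α β))) := by
  have h : ∀ M, stringWeight g N α (consSeq M β) ν =
      (∏ j ∈ Finset.range (N + 1), g (M - ν j) j / g (M - α j) j) *
      (upperWeight g N α β ν / (triProd g N β (shiftSeq α) * triProd g N α β)) := by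
    intro M
    have e1 : shiftSeq (consSeq M β) = β := rfl
    rw [stringWeight, upperWeight, e1, triProd_succ_left g N (consSeq M β),
      triProd_succ_left g N (consSeq M β), triProd_succ_right g N ν α,
      triProd_succ_right g N ν ν, hα, hν, e1, Finset.prod_div_distrib]
    have h1 : ∏ i ∈ Finset.range (N + 1), g (ν i - 0) (N - i) ≠ 0 :=
      Finset.prod_ne_zero_iff.2 fun _ _ => hg _ _
    have h2 : ∏ j ∈ Finset.range (N + 1), g (M - α j) j ≠ 0 :=
      Finset.prod_ne_zero_iff.2 fun _ _ => hg _ _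
    have h3 := triProd_ne_zero hg N
    have a1 := h3 ν ν
    have a2 := h3 β (shiftSeq α)
    have a3 := h3 α β
    have a4 := h3 ν (shiftSeq ν)
    simp only [consSeq]
    field_simp
  simp only [h]
  have := (tendsto_finsetProd (Finset.range (N + 1)) fun j _ =>
    tendsto_ratio hg hlim (ν j) (α j) j).mul_const
      (upperWeight g N α β ν / (triProd g N β (shiftSeq α) * triProd g N α β))
  simpa using this

theorem tendsto_stringWeight_lower {g : ℕ → ℕ → ℝ} (hg : ∀ n m, g n m ≠ 0)
    (hg0 : g 0 0 = 1)
    (hlim : ∀ m, Filter.Tendsto (fun n => g (n + 1) m / g n m) Filter.atTop (nhds 1))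
    (N k : ℕ) {α β κ : ℕ → ℕ} (hβ : β (N + 1) = 0) (hκ : κ (N + 1) = 0) :
    Filter.Tendsto (fun M => stringWeight g (N + 1) α (consSeq M β) (consSeq (M - k) κ))
      Filter.atTop (nhds (g k 0 * lowerWeight g (N + 1) α β κ /
        (triProd g (N + 1) β (shiftSeq α) * triProd g (N + 1) α β))) := by
  have h : ∀ M ≥ k, stringWeight g (N + 1) α (consSeq M β) (consSeq (M - k) κ) =
      ((∏ j ∈ Finset.range (N + 2), g (M - (k + α j)) j / g (M - α j) j) *
      (∏ j ∈ Finset.range (N + 1), g (M - κ j) (j + 1) / g (M - (k + κ j)) (j + 1)) *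
      (∏ j ∈ Finset.range (N + 1), g (M - (k + β j)) j / g (M - (k + κ j)) j)) *
      (g k 0 * lowerWeight g (N + 1) α β κ /
        (triProd g (N + 1) β (shiftSeq α) * triProd g (N + 1) α β)) := by
    intro M hM
    have e1 : shiftSeq (consSeq M β) = β := rfl
    have e2 : shiftSeq (consSeq (M - k) κ) = κ := rfl
    have e3 : ∀ i, consSeq (M - k) κ (i + 1) = κ i := fun _ => rfl
    have e4 : ∀ m f, consSeq m f 0 = m := fun _ _ => rfl
    rw [stringWeight, lowerWeight, e1, e2, triProd_succ_left g (N + 1) (consSeq M β),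
      triProd_succ_left g (N + 1) (consSeq M β),
      triProd_succ_left g (N + 1) (consSeq (M - k) κ),
      triProd_succ_left g (N + 1) (consSeq (M - k) κ), e1, e2,
      triProd_succ_left g N (consSeq (M - k) κ),
      triProd_succ_left g N (consSeq (M - k) κ), e2,
      triProd_succ_right g N κ (shiftSeq κ), triProd_succ_right g N κ (shiftSeq β),
      Finset.prod_range_succ' (fun j => g (consSeq M β 0 - consSeq (M - k) κ j) j),
      Finset.prod_range_succ' (fun j => g (consSeq (M - k) κ 0 - consSeq (M - k) κ j) j)]
    simp only [e3, e4, Finset.prod_div_distrib, Nat.sub_self, hg0, mul_one, Nat.sub_sub]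
    have e5 : M - (M - k) = k := by omega
    have e6 : shiftSeq κ N = 0 := hκ
    have e7 : shiftSeq β N = 0 := hβ
    rw [e5, e6, e7]
    have h1 : ∏ i ∈ Finset.range (N + 1), g (κ i - 0) (N - i) ≠ 0 :=
      Finset.prod_ne_zero_iff.2 fun _ _ => hg _ _
    have h2 : ∏ j ∈ Finset.range (N + 2), g (M - α j) j ≠ 0 :=
      Finset.prod_ne_zero_iff.2 fun _ _ => hg _ _
    have h4 : ∏ j ∈ Finset.range (N + 1), g (M - (k + κ j)) j ≠ 0 :=
      Finset.prod_ne_zero_iff.2 fun _ _ => hg _ _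
    have h5 : ∏ j ∈ Finset.range (N + 1), g (M - (k + κ j)) (j + 1) ≠ 0 :=
      Finset.prod_ne_zero_iff.2 fun _ _ => hg _ _
    have h3 := triProd_ne_zero hg (N + 1)
    have a1 := h3 κ κ
    have a2 := h3 β (shiftSeq α)
    have a3 := h3 α β
    have a4 := triProd_ne_zero hg N κ (shiftSeq κ)
    field_simp
  have := (((tendsto_finsetProd (Finset.range (N + 2)) fun j _ =>
    tendsto_ratio hg hlim (k + α j) (α j) j).mul
    (tendsto_finsetProd (Finset.range (N + 1)) fun j _ =>
      tendsto_ratio hg hlim (κ j) (k + κ j) (j + 1))).mul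
    (tendsto_finsetProd (Finset.range (N + 1)) fun j _ =>
      tendsto_ratio hg hlim (k + β j) (k + κ j) j)).mul_const
      (g k 0 * lowerWeight g (N + 1) α β κ /
        (triProd g (N + 1) β (shiftSeq α) * triProd g (N + 1) α β))
  simp only [Finset.prod_const_one, one_mul] at this
  refine this.congr' ?_
  filter_upwards [Filter.eventually_ge_atTop k] with M hM
  rw [h M hM]

/-- Sequences `ν` with `α j ≤ ν j`, `ν (j + 1) ≤ β j` and `|ν| = |α| + R`. -/
noncomputable def upperSet (N : ℕ) (α β : ℕ → ℕ) (R : ℕ) : Finset (ℕ →₀ ℕ) :=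
  ((Finset.range (N + 1)).finsupp fun j => Finset.Icc (α j) (consSeq (α 0 + R) β j)).filter
    fun ν => ∑ j ∈ Finset.range (N + 1), (ν j - α j) = R

/-- Pairs `(k, κ)` with `α (j + 1) ≤ κ j ≤ β j` and `k + |β| - |κ| = R`. -/
noncomputable def lowerSet (N : ℕ) (α β : ℕ → ℕ) (R : ℕ) : Finset (ℕ × (ℕ →₀ ℕ)) :=
  ((Finset.range (R + 1)) ×ˢ
    ((Finset.range N).finsupp fun j => Finset.Icc (α (j + 1)) (β j))).filter
    fun p => p.1 + ∑ j ∈ Finset.range N, (β j - p.2 j) = R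

theorem sum_upperWeight_eq_of_stringWeight {g : ℕ → ℕ → ℝ} (hg : ∀ n m, g n m ≠ 0)
    (hg0 : g 0 0 = 1)
    (hlim : ∀ m, Filter.Tendsto (fun n => g (n + 1) m / g n m) Filter.atTop (nhds 1))
    (N : ℕ) {α β : ℕ → ℕ} (hα : ∀ j, N ≤ j → α j = 0) (hβ : ∀ j, N ≤ j → β j = 0) (R : ℕ)
    (hid : ∀ M, α 0 ≤ M →
      ∑ v ∈ ((Finset.range (N + 2)).finsupp fun j => Finset.Icc (α j) (consSeq M β j)) with
        ∑ j ∈ Finset.range (N + 2), (v j - α j) = R,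
        stringWeight g (N + 1) α (consSeq M β) (v : ℕ →₀ ℕ) =
      ∑ v ∈ ((Finset.range (N + 2)).finsupp fun j => Finset.Icc (α j) (consSeq M β j)) with
        ∑ j ∈ Finset.range (N + 2), (consSeq M β j - v j) = R,
        stringWeight g (N + 1) α (consSeq M β) (v : ℕ →₀ ℕ)) :
    ∑ ν ∈ upperSet (N + 1) α β R, upperWeight g (N + 1) α β ν =
      ∑ p ∈ lowerSet (N + 1) α β R, g p.1 0 * lowerWeight g (N + 1) α β p.2 := by
  have hL : Filter.Tendsto (fun M => ∑ v ∈ upperSet (N + 1) α β R,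
      stringWeight g (N + 1) α (consSeq M β) v) Filter.atTop
      (nhds (∑ v ∈ upperSet (N + 1) α β R, upperWeight g (N + 1) α β v /
        (triProd g (N + 1) β (shiftSeq α) * triProd g (N + 1) α β))) := by
    refine tendsto_finsetSum _ fun v hv => tendsto_stringWeight_upper hg hlim _ (hα _ (by omega)) ?_
    rw [upperSet, Finset.mem_filter, Finset.mem_finsupp_iff] at hv
    have := (Finset.mem_Icc.1 (hv.1.2 (N + 1) (by simp))).2
    simpa [consSeq, hβ N le_rfl] using this
  have hR : Filter.Tendsto (fun M => ∑ p ∈ lowerSet (N + 1) α β R,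
      stringWeight g (N + 1) α (consSeq M β) (consSeq (M - p.1) p.2)) Filter.atTop
      (nhds (∑ p ∈ lowerSet (N + 1) α β R, g p.1 0 * lowerWeight g (N + 1) α β p.2 /
        (triProd g (N + 1) β (shiftSeq α) * triProd g (N + 1) α β))) := by
    refine tendsto_finsetSum _ fun p hp =>
      tendsto_stringWeight_lower hg hg0 hlim _ _ (hβ _ (by omega)) ?_
    rw [lowerSet, Finset.mem_filter, Finset.mem_product, Finset.mem_finsupp_iff] at hp
    exact Finsupp.notMem_support_iff.1 fun h => by simpa using hp.1.2.1 h
  have hev : ∀ M ≥ α 0 + R, ∑ v ∈ upperSet (N + 1) α β R,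
      stringWeight g (N + 1) α (consSeq M β) v = ∑ p ∈ lowerSet (N + 1) α β R,
      stringWeight g (N + 1) α (consSeq M β) (consSeq (M - p.1) p.2) := by
    intro M hM
    have := hid M (by omega)
    convert this using 1
    · refine Finset.sum_congr ?_ fun _ _ => rfl
      ext v
      simp only [upperSet, Finset.mem_filter, Finset.mem_finsupp_iff, and_congr_left_iff,
        and_congr_right_iff]
      intro hv _
      refine forall₂_congr fun j hj => ?_
      rcases j with _ | j
      · have : v 0 - α 0 ≤ R := by
          rw [← hv]
          exact Finset.single_le_sum (f := fun j => v j - α j) (fun _ _ => Nat.zero_le _) hj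
        simp only [consSeq, Finset.mem_Icc]
        omega
      · simp [consSeq]
    · refine Finset.sum_bij' (fun p _ => consFinsupp (M - p.1) p.2)
        (fun v _ => (M - v 0, v.comapDomain Nat.succ (Nat.succ_injective.injOn))) ?_ ?_ ?_ ?_ ?_
      · intro p hp
        simp only [lowerSet, Finset.mem_filter, Finset.mem_product, Finset.mem_finsupp_iff,
          Finset.mem_range] at hp ⊢
        obtain ⟨⟨hp1, hp2, hp3⟩, hp4⟩ := hp
        refine ⟨⟨?_, ?_⟩, ?_⟩
        · intro j hj
          rw [Finsupp.mem_support_iff, coe_consFinsupp] at hj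
          rcases j with _ | j
          · simp
          · have := hp2 (Finsupp.mem_support_iff.2 hj)
            simp only [Finset.mem_range] at this ⊢
            omega
        · intro j hj
          rw [coe_consFinsupp]
          rcases j with _ | j
          · simp only [consSeq, Finset.mem_Icc]
            omega
          · exact hp3 j (by omega)
        · rw [Finset.sum_range_succ', coe_consFinsupp]
          simp only [consSeq]
          omega
      · intro v hv
        simp only [lowerSet, Finset.mem_filter, Finset.mem_product, Finset.mem_finsupp_iff,
          Finset.mem_range] at hv ⊢
        obtain ⟨⟨hv1, hv2⟩, hv3⟩ := hv
        rw [Finset.sum_range_succ'] at hv3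
        simp only [consSeq] at hv3
        refine ⟨⟨by omega, ?_, ?_⟩, ?_⟩
        · intro j hj
          rw [Finsupp.mem_support_iff, Finsupp.comapDomain_apply] at hj
          have := hv1 (Finsupp.mem_support_iff.2 hj)
          simp only [Finset.mem_range] at this ⊢
          omega
        · intro j hj
          exact hv2 (j + 1) (by omega)
        · simp only [Finsupp.comapDomain_apply, Nat.succ_eq_add_one]
          omega
      · intro p hp
        simp only [lowerSet, Finset.mem_filter, Finset.mem_product, Finset.mem_range] at hp
        refine Prod.ext ?_ ?_
        · change M - (M - p.1) = p.1
          omega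
        · ext j
          rfl
      · intro v hv
        simp only [Finset.mem_filter, Finset.mem_finsupp_iff] at hv
        have := Finset.mem_Icc.1 (hv.1.2 0 (by simp))
        simp only [consSeq] at this
        ext j
        rw [coe_consFinsupp]
        rcases j with _ | j
        · simp only [consSeq]
          omega
        · rfl
      · intro p hp
        rfl
  have hlimeq := tendsto_nhds_unique (hL.congr' ?_) hR
  · simp only [← Finset.sum_div] at hlimeq
    rwa [div_left_inj' (mul_ne_zero (triProd_ne_zero hg _ _ _) (triProd_ne_zero hg _ _ _))]
      at hlimeq
  · filter_upwards [Filter.eventually_ge_atTop (α 0 + R)] with M hM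
    exact hev M hM

theorem fmac_zero (q t : ℝ) (m : ℕ) : fmac q t 0 m = 1 := by simp [fmac]

theorem fmac_succ (q t : ℝ) (n m : ℕ) : fmac q t (n + 1) m =
    fmac q t n m * ((1 - q ^ n * t ^ (m + 1)) / (1 - q ^ (n + 1) * t ^ m)) :=
  Finset.prod_range_succ _ _

theorem one_sub_pow_mul_pow_pos {q t : ℝ} (hq0 : 0 ≤ q) (hq1 : q < 1) (ht0 : 0 ≤ t) (ht1 : t < 1)
    {a b : ℕ} (hab : a ≠ 0 ∨ b ≠ 0) : 0 < 1 - q ^ a * t ^ b := by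
  rw [sub_pos]
  rcases hab with h | h
  · exact mul_lt_one_of_nonneg_of_lt_one_left (pow_nonneg hq0 _) (pow_lt_one₀ hq0 hq1 h)
      (pow_le_one₀ ht0 ht1.le)
  · exact mul_lt_one_of_nonneg_of_lt_one_right (pow_le_one₀ hq0 hq1.le) (pow_nonneg ht0 _)
      (pow_lt_one₀ ht0 ht1 h)

theorem fmac_pos {q t : ℝ} (hq0 : 0 ≤ q) (hq1 : q < 1) (ht0 : 0 ≤ t) (ht1 : t < 1) (n m : ℕ) :
    0 < fmac q t n m :=
  Finset.prod_pos fun _ _ => div_pos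
    (one_sub_pow_mul_pow_pos hq0 hq1 ht0 ht1 (Or.inr m.succ_ne_zero))
    (one_sub_pow_mul_pow_pos hq0 hq1 ht0 ht1 (Or.inl (Nat.succ_ne_zero _)))

theorem tendsto_fmac_ratio {q t : ℝ} (hq0 : 0 ≤ q) (hq1 : q < 1) (ht0 : 0 ≤ t) (ht1 : t < 1)
    (m : ℕ) :
    Filter.Tendsto (fun n => fmac q t (n + 1) m / fmac q t n m) Filter.atTop (nhds 1) := by
  have h := tendsto_pow_atTop_nhds_zero_of_lt_one hq0 hq1
  have h1 : Filter.Tendsto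
      (fun n : ℕ => (1 - q ^ n * t ^ (m + 1)) / (1 - q ^ (n + 1) * t ^ m)) Filter.atTop
      (nhds ((1 - 0 * t ^ (m + 1)) / (1 - 0 * t ^ m))) :=
    (tendsto_const_nhds.sub (h.mul_const _)).div
      (tendsto_const_nhds.sub ((h.comp (Filter.tendsto_add_atTop_nat 1)).mul_const _)) (by simp)
  simp only [zero_mul, sub_zero, div_one] at h1
  refine h1.congr fun n => ?_
  rw [fmac_succ, mul_div_cancel_left₀ _ (fmac_pos hq0 hq1 ht0 ht1 n m).ne']

theorem pairWeight_eq_fmac {q t : ℝ} (hq0 : 0 < q) (hq1 : q < 1) (ht0 : 0 < t) (ht1 : t < 1)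
    {i j k l : ℕ} (hij : i ≤ j) (hkl : k < l) :
    pairWeight q (t / q) (t ^ j / q ^ k) (t ^ i / q ^ l) =
      fmac q t (l - k) (j - i) * fmac q t (l - k) (j - i) /
        (fmac q t (l - k - 1) (j - i) * fmac q t (l - k + 1) (j - i)) := by
  obtain ⟨m, rfl⟩ := Nat.exists_eq_add_of_le hij
  obtain ⟨d, rfl⟩ := Nat.exists_eq_add_of_lt hkl
  have e1 : k + d + 1 - k = d + 1 := by omega
  rw [Nat.add_sub_cancel_left, e1, Nat.add_sub_cancel, fmac_succ q t (d + 1), fmac_succ q t d]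
  have h0 := (fmac_pos hq0.le hq1 ht0.le ht1 d m).ne'
  have p := fun a b => one_sub_pow_mul_pow_pos hq0.le hq1 ht0.le ht1 (a := a) (b := b)
  have h1 := (p (d + 1) m (Or.inl (by omega))).ne'
  have h2 := (p (d + 1) (m + 1) (Or.inl (by omega))).ne'
  have h3 := (p (d + 1 + 1) m (Or.inl (by omega))).ne'
  have h4 := (p d (m + 1) (Or.inr (by omega))).ne'
  have hq := hq0.ne'
  have ht := ht0.ne'
  have hx : t ^ (i + m) / q ^ k = q ^ (d + 1) * t ^ m * (t ^ i / q ^ (k + d + 1)) := by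
    field_simp
    ring
  have hy : t ^ i / q ^ (k + d + 1) ≠ 0 := by positivity
  rw [hx, pairWeight]
  generalize t ^ i / q ^ (k + d + 1) = y at hy
  have f1 : y - q * (q ^ (d + 1) * t ^ m * y) = (1 - q ^ (d + 1 + 1) * t ^ m) * y := by ring
  have f2 : y - t / q * (q ^ (d + 1) * t ^ m * y) = (1 - q ^ d * t ^ (m + 1)) * y := by
    field_simp
    ring
  have f3 : y - q ^ (d + 1) * t ^ m * y = (1 - q ^ (d + 1) * t ^ m) * y := by ring
  have f4 : y - q * (t / q) * (q ^ (d + 1) * t ^ m * y) =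
      (1 - q ^ (d + 1) * t ^ (m + 1)) * y := by
    field_simp
    ring
  rw [f1, f2, f3, f4]
  field_simp

theorem sum_upperWeight_eq_of_generic {q t : ℝ} (hq0 : 0 < q) (hq1 : q < 1) (ht0 : 0 < t)
    (ht1 : t < 1) (hgen : ∀ a b c d : ℕ, t ^ a * q ^ b = t ^ c * q ^ d → b = d)
    (N : ℕ) {α β : ℕ → ℕ} (hα : ∀ j, N ≤ j → α j = 0) (hβ : ∀ j, N ≤ j → β j = 0)
    (hβα : ∀ j, β j ≤ α j) (hαβ : ∀ j, α (j + 1) ≤ β j) (R : ℕ) :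
    ∑ ν ∈ upperSet (N + 1) α β R, upperWeight (fmac q t) (N + 1) α β ν =
      ∑ p ∈ lowerSet (N + 1) α β R,
        fmac q t p.1 0 * lowerWeight (fmac q t) (N + 1) α β p.2 := by
  have hg : ∀ n m, fmac q t n m ≠ 0 := fun n m => (fmac_pos hq0.le hq1 ht0.le ht1 n m).ne'
  refine sum_upperWeight_eq_of_stringWeight hg (fmac_zero _ _ _)
    (tendsto_fmac_ratio hq0.le hq1 ht0.le ht1) N hα hβ R fun M hM => ?_
  let x : (Σ _ : ℕ, ℕ) → ℝ := fun i => t ^ i.1 / q ^ i.2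
  let w : (Σ _ : ℕ, ℕ) → (Σ _ : ℕ, ℕ) → ℝ := fun i j => pairWeight q (t / q) (x i) (x j)
  have hq := hq0.ne'
  have ht := ht0.ne'
  have hqt : q * (t / q) = t := mul_div_cancel₀ _ hq
  have hw0 : ∀ j k, w ⟨j, k + 1⟩ ⟨j, k⟩ = 0 := by
    intro j k
    have : t ^ j / q ^ k - q * (t ^ j / q ^ (k + 1)) = 0 := by
      field_simp
      ring
    simp only [w, x, pairWeight, this, zero_mul, zero_div]
  have hw1 : ∀ i j k l, i ≤ j → k < l → w ⟨j, k⟩ ⟨i, l⟩ =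
      fmac q t (l - k) (j - i) * fmac q t (l - k) (j - i) /
        (fmac q t (l - k - 1) (j - i) * fmac q t (l - k + 1) (j - i)) :=
    fun i j k l hij hkl => pairWeight_eq_fmac hq0 hq1 ht0 ht1 hij hkl
  have hw2 : ∀ i j k l, i < j → l < k → w ⟨i, k⟩ ⟨j, l⟩ =
      fmac q t (k - l) (j - i - 1) * fmac q t (k - l) (j - i - 1) /
        (fmac q t (k - l - 1) (j - i - 1) * fmac q t (k - l + 1) (j - i - 1)) := by
    intro i j k l hij hkl
    obtain ⟨m, rfl⟩ := Nat.exists_eq_add_of_lt hij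
    have e : i + m + 1 - i - 1 = i + m - i := by omega
    rw [e, ← hw1 i (i + m) l k (by omega) hkl]
    simp only [w]
    rw [← pairWeight_reflect_left (by rwa [hqt]), hqt]
    congr 1
    simp only [x]
    field_simp
    ring
  have hab : ∀ j, α j ≤ consSeq M β j := by
    intro j
    rcases j with _ | j
    exacts [hM, hαβ j]
  have hba : ∀ j, consSeq M β (j + 1) ≤ α j := hβα
  have hanti : ∀ i j, i < j → consSeq M β j ≤ α i := by
    intro i j hij
    induction j, hij using Nat.le_induction with
    | base => exact hba i
    | succ j hj ih => exact (hba j).trans ((hab j).trans ih)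
  have hsum := sum_stringCells_eq w hw0 (N + 2) hab (fun u =>
    sum_cutWeight_eq q (t / q) u (by rwa [hqt]) (by
      rw [hqt]
      exact (pow_lt_one₀ ht0.le ht1 two_ne_zero).ne) x _
      (fun i _ => div_ne_zero (pow_ne_zero _ ht) (pow_ne_zero _ hq)) (by
        rintro ⟨i, k⟩ hi ⟨j, l⟩ hj hij e _ he
        rw [hqt] at he
        simp only [x] at he
        have hkl : l = k := by
          refine hgen i l (e + j) k ?_
          rw [pow_add]
          field_simp at he
          linarith
        subst hkl
        simp only [stringCells, Finset.mem_sigma, Finset.mem_Ico] at hi hj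
        rcases lt_trichotomy i j with h | h | h
        · have := hanti i j h
          omega
        · exact hij (by rw [h])
        · have := hanti j i h
          omega)) R
  have hc : ∀ v ∈ (Finset.range (N + 2)).finsupp (fun j => Finset.Icc (α j) (consSeq M β j)),
      cutWeight w (stringCells (N + 2) α (consSeq M β)) (stringCells (N + 2) α v) =
        stringWeight (fmac q t) (N + 1) α (consSeq M β) v := by
    intro v hv
    rw [Finset.mem_finsupp_iff] at hv
    have hv' : ∀ j, α j ≤ v j ∧ v j ≤ consSeq M β j := by
      intro j
      by_cases hj : j ∈ Finset.range (N + 2)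
      · exact Finset.mem_Icc.1 (hv.2 j hj)
      · rw [Finsupp.notMem_support_iff.1 fun h => hj (hv.1 h)]
        rw [Finset.mem_range, not_lt] at hj
        exact ⟨(hα j (by omega)).le, Nat.zero_le _⟩
    exact cutWeight_stringCells hg w hw1 hw2 (N + 1) (fun j => (hv' j).1) (fun j => (hv' j).2) hba
  refine Eq.trans ?_ (hsum.trans ?_)
  · exact Finset.sum_congr rfl fun v hv => (hc v (Finset.mem_filter.1 hv).1).symm
  · exact Finset.sum_congr rfl fun v hv => hc v (Finset.mem_filter.1 hv).1

theorem continuousOn_fmac (n m : ℕ) : ContinuousOn (fun p : ℝ × ℝ => fmac p.1 p.2 n m)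
    (Set.Ico 0 1 ×ˢ Set.Ico 0 1) := by
  refine continuousOn_finsetProd _ fun i _ => ContinuousOn.div (by fun_prop) (by fun_prop) ?_
  rintro ⟨q, t⟩ ⟨hq, ht⟩
  exact (one_sub_pow_mul_pow_pos hq.1 hq.2 ht.1 ht.2 (Or.inl i.succ_ne_zero)).ne'

theorem continuousOn_triProd (N : ℕ) (f h : ℕ → ℕ) :
    ContinuousOn (fun p : ℝ × ℝ => triProd (fmac p.1 p.2) N f h)
      (Set.Ico 0 1 ×ˢ Set.Ico 0 1) := by
  refine continuousOn_finsetProd _ fun i _ => continuousOn_finsetProd _ fun j _ => ?_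
  split_ifs
  exacts [continuousOn_fmac _ _, continuousOn_const]

theorem triProd_fmac_pos {q t : ℝ} (hq0 : 0 ≤ q) (hq1 : q < 1) (ht0 : 0 ≤ t) (ht1 : t < 1)
    (N : ℕ) (f h : ℕ → ℕ) : 0 < triProd (fmac q t) N f h := by
  refine Finset.prod_pos fun i _ => Finset.prod_pos fun j _ => ?_
  split_ifs
  exacts [fmac_pos hq0 hq1 ht0 ht1 _ _, one_pos]

theorem continuousOn_upperWeight (N : ℕ) (α β ν : ℕ → ℕ) :
    ContinuousOn (fun p : ℝ × ℝ => upperWeight (fmac p.1 p.2) N α β ν)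
      (Set.Ico 0 1 ×ˢ Set.Ico 0 1) := by
  have h := continuousOn_triProd N
  refine ContinuousOn.div ((((h _ _).mul (h _ _)).mul (h _ _)).mul (h _ _))
    ((h _ _).mul (h _ _)) ?_
  rintro ⟨q, t⟩ ⟨hq, ht⟩
  exact (mul_pos (triProd_fmac_pos hq.1 hq.2 ht.1 ht.2 _ _ _)
    (triProd_fmac_pos hq.1 hq.2 ht.1 ht.2 _ _ _)).ne'

theorem continuousOn_lowerWeight (N : ℕ) (α β κ : ℕ → ℕ) :
    ContinuousOn (fun p : ℝ × ℝ => lowerWeight (fmac p.1 p.2) N α β κ)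
      (Set.Ico 0 1 ×ˢ Set.Ico 0 1) := by
  have h := continuousOn_triProd N
  refine ContinuousOn.div ((((h _ _).mul (h _ _)).mul (h _ _)).mul (h _ _))
    ((h _ _).mul (h _ _)) ?_
  rintro ⟨q, t⟩ ⟨hq, ht⟩
  exact (mul_pos (triProd_fmac_pos hq.1 hq.2 ht.1 ht.2 _ _ _)
    (triProd_fmac_pos hq.1 hq.2 ht.1 ht.2 _ _ _)).ne'

theorem countable_nongeneric {q : ℝ} (hq0 : 0 < q) (hq1 : q < 1) :
    {t : ℝ | 0 < t ∧ ¬ ∀ a b c d : ℕ, t ^ a * q ^ b = t ^ c * q ^ d → b = d}.Countable := by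
  have hsub : {t : ℝ | 0 < t ∧ ¬ ∀ a b c d : ℕ, t ^ a * q ^ b = t ^ c * q ^ d → b = d} ⊆
      ⋃ p : (ℕ × ℕ) × (ℕ × ℕ), {t : ℝ | 0 < t ∧ t ^ p.1.1 * q ^ p.1.2 = t ^ p.2.1 * q ^ p.2.2 ∧
        p.1.2 ≠ p.2.2} := by
    rintro t ⟨ht, h⟩
    push Not at h
    obtain ⟨a, b, c, d, h1, h2⟩ := h
    exact Set.mem_iUnion.2 ⟨((a, b), (c, d)), ht, h1, h2⟩
  refine (Set.countable_iUnion fun p => ?_).mono hsub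
  obtain ⟨⟨a, b⟩, c, d⟩ := p
  refine Set.Finite.countable ?_
  let P : Polynomial ℝ := Polynomial.C (q ^ b) * Polynomial.X ^ a -
    Polynomial.C (q ^ d) * Polynomial.X ^ c
  by_cases hbd : b = d
  · simp [hbd]
  have hP : P ≠ 0 := by
    intro hP
    have h1 := congrArg (Polynomial.eval 1) hP
    simp only [P, Polynomial.eval_sub, Polynomial.eval_mul, Polynomial.eval_C,
      Polynomial.eval_pow, Polynomial.eval_X, one_pow, mul_one, Polynomial.eval_zero,
      sub_eq_zero] at h1
    exact hbd (pow_right_injective₀ hq0 hq1.ne h1)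
  refine (P.rootSet_finite ℝ).subset fun t ht => ?_
  rw [Polynomial.mem_rootSet]
  refine ⟨hP, ?_⟩
  have := ht.2.1
  simp only [P, map_sub, map_mul, Polynomial.aeval_C, map_pow, Polynomial.aeval_X]
  simp only [Algebra.algebraMap_self, RingHom.id_apply]
  linarith

/-- The local identity behind the skew Cauchy commutation relation. -/
theorem sum_upperWeight_eq {q t : ℝ} (hq0 : 0 ≤ q) (hq1 : q < 1) (ht0 : 0 ≤ t)
    (ht1 : t < 1) (N : ℕ) {α β : ℕ → ℕ} (hα : ∀ j, N ≤ j → α j = 0) (hβ : ∀ j, N ≤ j → β j = 0)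
    (hβα : ∀ j, β j ≤ α j) (hαβ : ∀ j, α (j + 1) ≤ β j) (R : ℕ) :
    ∑ ν ∈ upperSet (N + 1) α β R, upperWeight (fmac q t) (N + 1) α β ν =
      ∑ p ∈ lowerSet (N + 1) α β R,
        fmac q t p.1 0 * lowerWeight (fmac q t) (N + 1) α β p.2 := by
  let F : ℝ × ℝ → ℝ := fun x =>
    ∑ ν ∈ upperSet (N + 1) α β R, upperWeight (fmac x.1 x.2) (N + 1) α β ν
  let G : ℝ × ℝ → ℝ := fun x => ∑ p ∈ lowerSet (N + 1) α β R,
        fmac x.1 x.2 p.1 0 * lowerWeight (fmac x.1 x.2) (N + 1) α β p.2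
  have hF : ContinuousOn F (Set.Ico 0 1 ×ˢ Set.Ico 0 1) :=
    continuousOn_finsetSum _ fun _ _ => continuousOn_upperWeight _ _ _ _
  have hG : ContinuousOn G (Set.Ico 0 1 ×ˢ Set.Ico 0 1) :=
    continuousOn_finsetSum _ fun _ _ => (continuousOn_fmac _ _).mul (continuousOn_lowerWeight _ _ _ _)
  have h1 : ∀ q ∈ Set.Ioo (0 : ℝ) 1, ∀ t ∈ Set.Ico (0 : ℝ) 1, F (q, t) = G (q, t) := by
    intro q hq
    have hmap : Set.MapsTo (fun t : ℝ => (q, t)) (Set.Ico 0 1) (Set.Ico 0 1 ×ˢ Set.Ico 0 1) :=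
      fun t ht => ⟨⟨hq.1.le, hq.2⟩, ht⟩
    have hcont : ContinuousOn (fun t : ℝ => (q, t)) (Set.Ico 0 1) := by fun_prop
    let B := {t : ℝ | 0 < t ∧ ¬ ∀ a b c d : ℕ, t ^ a * q ^ b = t ^ c * q ^ d → b = d}
    have hEq : Set.EqOn (F ∘ fun t => (q, t)) (G ∘ fun t => (q, t)) (Set.Ioo 0 1 ∩ Bᶜ) := by
      rintro t ⟨ht, htB⟩
      have hgen : ∀ a b c d : ℕ, t ^ a * q ^ b = t ^ c * q ^ d → b = d := by
        by_contra h
        exact htB ⟨ht.1, h⟩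
      exact sum_upperWeight_eq_of_generic hq.1 hq.2 ht.1 ht.2 hgen N hα hβ hβα hαβ R
    have hdense : Dense Bᶜ := (countable_nongeneric hq.1 hq.2).dense_compl ℝ
    refine hEq.of_subset_closure (hF.comp hcont hmap) (hG.comp hcont hmap)
      (Set.inter_subset_left.trans Set.Ioo_subset_Ico_self) ?_
    have h2 := closure_minimal (hdense.open_subset_closure_inter (isOpen_Ioo (a := 0) (b := 1))) isClosed_closure
    rw [closure_Ioo zero_ne_one] at h2
    exact Set.Ico_subset_Icc_self.trans h2
  have hmap : Set.MapsTo (fun q : ℝ => (q, t)) (Set.Ico 0 1) (Set.Ico 0 1 ×ˢ Set.Ico 0 1) :=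
    fun q hq => ⟨hq, ht0, ht1⟩
  have hcont : ContinuousOn (fun q : ℝ => (q, t)) (Set.Ico 0 1) := by fun_prop
  have hEq : Set.EqOn (F ∘ fun q => (q, t)) (G ∘ fun q => (q, t)) (Set.Ioo 0 1) :=
    fun q hq => h1 q hq t ⟨ht0, ht1⟩
  refine hEq.of_subset_closure (hF.comp hcont hmap) (hG.comp hcont hmap)
    Set.Ioo_subset_Ico_self ?_ ⟨hq0, hq1⟩
  rw [closure_Ioo zero_ne_one]
  exact Set.Ico_subset_Icc_self

open scoped ENNReal

/-- Interlacing of sequences. -/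
def Interlaces (f h : ℕ → ℕ) : Prop := ∀ j, f j ≤ h j ∧ h (j + 1) ≤ f j

/-- A bound beyond which a finitely supported sequence vanishes. -/
def lengthBound (f : ℕ →₀ ℕ) : ℕ := f.support.sup id + 1

theorem eq_zero_of_lengthBound_le (f : ℕ →₀ ℕ) {j : ℕ} (hj : lengthBound f ≤ j) : f j = 0 := by
  by_contra h
  have : j ≤ f.support.sup id := Finset.le_sup (f := id) (Finsupp.mem_support_iff.2 h)
  unfold lengthBound at hj
  omega

theorem degree_eq_sum_range (f : ℕ →₀ ℕ) {N : ℕ} (hN : ∀ j, N ≤ j → f j = 0) :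
    f.degree = ∑ j ∈ Finset.range N, f j := by
  rw [Finsupp.degree_apply]
  refine Finset.sum_subset (fun j hj => ?_) fun j _ hj => Finsupp.notMem_support_iff.1 hj
  rw [Finset.mem_range]
  by_contra h
  exact Finsupp.mem_support_iff.1 hj (hN j (not_lt.1 h))

/-- Weight of a step up from `f` to `h`, truncated at `N`. -/
noncomputable def upStepAux (g : ℕ → ℕ → ℝ) (N : ℕ) (f h : ℕ → ℕ) : ℝ :=
  triProd g N h f * triProd g N f (shiftSeq h) /
    (triProd g N f (shiftSeq f) * triProd g N h h)

/-- Weight of a step down from `h` to `f`, truncated at `N`. -/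
noncomputable def downStepAux (g : ℕ → ℕ → ℝ) (N : ℕ) (h f : ℕ → ℕ) : ℝ :=
  triProd g N h f * triProd g N f (shiftSeq h) /
    (triProd g N h (shiftSeq h) * triProd g N f f)

theorem stepAux_stable {g : ℕ → ℕ → ℝ} (hg : ∀ n m, g n m ≠ 0) {N M : ℕ} (hNM : N ≤ M)
    {f h : ℕ → ℕ} (hf : ∀ j, N ≤ j → f j = 0) (hh : ∀ j, N ≤ j → h j = 0) :
    upStepAux g M f h = upStepAux g N f h ∧ downStepAux g M h f = downStepAux g N h f := by
  induction M, hNM using Nat.le_induction with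
  | base => exact ⟨rfl, rfl⟩
  | succ M hM ih =>
    rw [← ih.1, ← ih.2]
    have e1 : shiftSeq f M = 0 := hf _ (by omega)
    have e2 : shiftSeq h M = 0 := hh _ (by omega)
    have h1 : ∀ k : ℕ → ℕ, ∏ i ∈ Finset.range (M + 1), g (k i - 0) (M - i) ≠ 0 := fun _ =>
      Finset.prod_ne_zero_iff.2 fun _ _ => hg _ _
    have a1 := h1 f
    have a2 := h1 h
    have b1 := triProd_ne_zero hg M f (shiftSeq f)
    have b2 := triProd_ne_zero hg M h (shiftSeq h)
    have b3 := triProd_ne_zero hg M f f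
    have b4 := triProd_ne_zero hg M h h
    simp only [upStepAux, downStepAux, triProd_succ_right, e1, e2, hf M hM, hh M hM]
    constructor <;> field_simp

/-- Weight of a step up. -/
noncomputable def upStep (g : ℕ → ℕ → ℝ) (f h : ℕ →₀ ℕ) : ℝ :=
  upStepAux g (max (lengthBound f) (lengthBound h)) f h

/-- Weight of a step down. -/
noncomputable def downStep (g : ℕ → ℕ → ℝ) (h f : ℕ →₀ ℕ) : ℝ :=
  downStepAux g (max (lengthBound f) (lengthBound h)) h f

theorem step_eq_aux {g : ℕ → ℕ → ℝ} (hg : ∀ n m, g n m ≠ 0) {N : ℕ} {f h : ℕ →₀ ℕ}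
    (hf : ∀ j, N ≤ j → f j = 0) (hh : ∀ j, N ≤ j → h j = 0) :
    upStep g f h = upStepAux g N f h ∧ downStep g h f = downStepAux g N h f := by
  have h1 := stepAux_stable hg (Nat.le_add_right N (max (lengthBound f) (lengthBound h))) hf hh
  have h2 := stepAux_stable hg (Nat.le_add_left (max (lengthBound f) (lengthBound h)) N)
    (fun j hj => eq_zero_of_lengthBound_le f ((le_max_left _ _).trans hj))
    (fun j hj => eq_zero_of_lengthBound_le h ((le_max_right _ _).trans hj))
  exact ⟨h2.1.symm.trans h1.1, h2.2.symm.trans h1.2⟩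

open Classical in
/-- The transfer operator adding a horizontal strip. -/
noncomputable def upOp (g : ℕ → ℕ → ℝ) (x : ℝ≥0∞) (f h : ℕ →₀ ℕ) : ℝ≥0∞ :=
  if Interlaces f h then ENNReal.ofReal (upStep g f h) * x ^ (h.degree - f.degree) else 0

open Classical in
/-- The transfer operator removing a horizontal strip. -/
noncomputable def downOp (g : ℕ → ℕ → ℝ) (y : ℝ≥0∞) (h f : ℕ →₀ ℕ) : ℝ≥0∞ :=
  if Interlaces f h then ENNReal.ofReal (downStep g h f) * y ^ (h.degree - f.degree) else 0

theorem mul_max_min {M : Type*} [CommMonoid M] (F : ℕ → M) (a b : ℕ) :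
    F (max a b) * F (min a b) = F a * F b := by
  rcases le_total a b with h | h
  · rw [max_eq_right h, min_eq_left h, mul_comm]
  · rw [max_eq_left h, min_eq_right h]

theorem triProd_mul_max_min_right {K : Type*} [CommMonoid K] (g : ℕ → ℕ → K) (N : ℕ)
    (f a b : ℕ → ℕ) :
    triProd g N f (fun j => max (a j) (b j)) * triProd g N f (fun j => min (a j) (b j)) =
      triProd g N f a * triProd g N f b := by
  simp only [triProd, ← Finset.prod_mul_distrib]
  refine Finset.prod_congr rfl fun i _ => Finset.prod_congr rfl fun j _ => ?_
  split_ifs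
  · exact mul_max_min (fun x => g (f i - x) (j - i)) _ _
  · rfl

theorem triProd_mul_max_min_left {K : Type*} [CommMonoid K] (g : ℕ → ℕ → K) (N : ℕ)
    (f a b : ℕ → ℕ) :
    triProd g N (fun j => max (a j) (b j)) f * triProd g N (fun j => min (a j) (b j)) f =
      triProd g N a f * triProd g N b f := by
  simp only [triProd, ← Finset.prod_mul_distrib]
  refine Finset.prod_congr rfl fun i _ => Finset.prod_congr rfl fun j _ => ?_
  split_ifs
  · exact mul_max_min (fun x => g (x - f j) (j - i)) _ _
  · rfl

theorem upperWeight_max_min (g : ℕ → ℕ → ℝ) (N : ℕ) (a b ν : ℕ → ℕ) :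
    upperWeight g N (fun j => max (a j) (b j)) (fun j => min (a j) (b j)) ν =
      upperWeight g N a b ν := by
  simp only [upperWeight, triProd_mul_max_min_right, mul_assoc, triProd_mul_max_min_left]

theorem lowerWeight_max_min (g : ℕ → ℕ → ℝ) (N : ℕ) (a b κ : ℕ → ℕ) :
    lowerWeight g N (fun j => max (a j) (b j)) (fun j => min (a j) (b j)) κ =
      lowerWeight g N a b κ := by
  have := triProd_mul_max_min_right g N κ (shiftSeq a) (shiftSeq b)
  simp only [lowerWeight, triProd_mul_max_min_left, mul_assoc]
  rw [← this]
  rfl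

theorem mem_upperSet {N : ℕ} {α β : ℕ → ℕ} (hα : ∀ j, N ≤ j → α j = 0)
    (hβ : ∀ j, N ≤ j → β j = 0) (R : ℕ) (ν : ℕ →₀ ℕ) :
    ν ∈ upperSet (N + 1) α β R ↔ (∀ j, α j ≤ ν j ∧ ν (j + 1) ≤ β j) ∧
      ∑ j ∈ Finset.range (N + 2), (ν j - α j) = R := by
  rw [upperSet, Finset.mem_filter, Finset.mem_finsupp_iff, and_congr_left_iff]
  intro hR
  constructor
  · rintro ⟨h1, h2⟩ j
    have h0 : ∀ j, N + 2 ≤ j → ν j = 0 := fun j hj =>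
      Finsupp.notMem_support_iff.1 fun h => by
        have := Finset.mem_range.1 (h1 h)
        omega
    constructor
    · by_cases hj : j < N + 2
      · exact (Finset.mem_Icc.1 (h2 j (Finset.mem_range.2 hj))).1
      · rw [hα j (by omega)]
        exact Nat.zero_le _
    · by_cases hj : j + 1 < N + 2
      · exact (Finset.mem_Icc.1 (h2 (j + 1) (Finset.mem_range.2 hj))).2
      · rw [h0 _ (by omega)]
        exact Nat.zero_le _
  · intro h
    refine ⟨fun j hj => ?_, fun j hj => ?_⟩
    · by_contra hj'
      rw [Finset.mem_range] at hj'
      obtain ⟨i, rfl⟩ : ∃ i, j = i + 1 := ⟨j - 1, by omega⟩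
      have := (h i).2
      rw [hβ i (by omega)] at this
      exact Finsupp.mem_support_iff.1 hj (by omega)
    · rw [Finset.mem_Icc]
      refine ⟨(h j).1, ?_⟩
      rcases j with _ | j
      · have : ν 0 - α 0 ≤ R := by
          rw [← hR]
          exact Finset.single_le_sum (f := fun j => ν j - α j) (fun _ _ => Nat.zero_le _) hj
        simp only [consSeq]
        omega
      · exact (h j).2

theorem mem_lowerSet {N : ℕ} {α β : ℕ → ℕ} (hα : ∀ j, N ≤ j → α j = 0)
    (hβ : ∀ j, N ≤ j → β j = 0) (R : ℕ) (p : ℕ × (ℕ →₀ ℕ)) :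
    p ∈ lowerSet N α β R ↔ (∀ j, α (j + 1) ≤ p.2 j ∧ p.2 j ≤ β j) ∧
      p.1 + ∑ j ∈ Finset.range N, (β j - p.2 j) = R := by
  rw [lowerSet, Finset.mem_filter, Finset.mem_product, Finset.mem_finsupp_iff, and_congr_left_iff]
  intro hR
  constructor
  · rintro ⟨_, h1, h2⟩ j
    by_cases hj : j < N
    · exact Finset.mem_Icc.1 (h2 j (Finset.mem_range.2 hj))
    · have : p.2 j = 0 := Finsupp.notMem_support_iff.1 fun h => hj (Finset.mem_range.1 (h1 h))
      rw [this, hα _ (by omega)]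
      exact ⟨le_rfl, Nat.zero_le _⟩
  · intro h
    refine ⟨Finset.mem_range.2 (by omega), fun j hj => ?_, fun j _ => Finset.mem_Icc.2 (h j)⟩
    by_contra hj'
    rw [Finset.mem_range] at hj'
    have := (h j).2
    rw [hβ j (by omega)] at this
    exact Finsupp.mem_support_iff.1 hj (by omega)

theorem ENNReal.tsum_eq_tsum_sum_fiber {X : Type*} {F : X → ℝ≥0∞} {S : ℕ → Finset X}
    {c : X → Prop} {r : X → ℕ} {G : X → ℝ≥0∞} {z : ℕ → ℝ≥0∞}
    (hS : ∀ R x, x ∈ S R ↔ c x ∧ r x = R) (h1 : ∀ x, c x → F x = G x * z (r x))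
    (h0 : ∀ x, ¬ c x → F x = 0) :
    ∑' x, F x = ∑' R, (∑ x ∈ S R, G x) * z R := by
  classical
  have h : ∀ R, (∑ x ∈ S R, G x) * z R = ∑' x, if x ∈ S R then G x * z R else 0 := by
    intro R
    rw [tsum_eq_sum (s := S R) fun x hx => if_neg hx, Finset.sum_mul]
    exact Finset.sum_congr rfl fun x hx => (if_pos hx).symm
  simp only [h]
  rw [ENNReal.tsum_comm]
  refine tsum_congr fun x => ?_
  by_cases hx : c x
  · rw [tsum_eq_single (r x), if_pos ((hS _ _).2 ⟨hx, rfl⟩), h1 x hx]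
    intro R hR
    rw [if_neg]
    rw [hS]
    exact fun h => hR h.2.symm
  · rw [h0 x hx]
    symm
    refine ENNReal.tsum_eq_zero.2 fun R => if_neg ?_
    rw [hS]
    exact fun h => hx h.1

theorem tsum_upOp_mul_downOp {q t : ℝ} (hq0 : 0 ≤ q) (hq1 : q < 1) (ht0 : 0 ≤ t)
    (ht1 : t < 1) (x y : ℝ≥0∞) (f h : ℕ →₀ ℕ) :
    ∑' ν, upOp (fmac q t) x f ν * downOp (fmac q t) y ν h =
      (∑' k, ENNReal.ofReal (fmac q t k 0) * (x * y) ^ k) *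
        ∑' κ, downOp (fmac q t) y f κ * upOp (fmac q t) x κ h := by
  have hpos := fmac_pos hq0 hq1 ht0 ht1
  have hg : ∀ n m, fmac q t n m ≠ 0 := fun n m => (hpos n m).ne'
  have htri := triProd_fmac_pos hq0 hq1 ht0 ht1
  obtain ⟨N, hf, hh⟩ : ∃ N, (∀ j, N ≤ j → f j = 0) ∧ ∀ j, N ≤ j → h j = 0 :=
    ⟨max (lengthBound f) (lengthBound h),
      fun j hj => eq_zero_of_lengthBound_le f ((le_max_left _ _).trans hj),
      fun j hj => eq_zero_of_lengthBound_le h ((le_max_right _ _).trans hj)⟩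
  set g := fmac q t with hgdef
  let α : ℕ → ℕ := fun j => max (f j) (h j)
  let β : ℕ → ℕ := fun j => min (f j) (h j)
  have hα : ∀ j, N ≤ j → α j = 0 := fun j hj => by simp [α, hf j hj, hh j hj]
  have hβ : ∀ j, N ≤ j → β j = 0 := fun j hj => by simp [β, hf j hj]
  have hβα : ∀ j, β j ≤ α j := fun j => min_le_max
  have hU : ∀ ν : ℕ →₀ ℕ, (Interlaces f ν ∧ Interlaces h ν) ↔ ∀ j, α j ≤ ν j ∧ ν (j + 1) ≤ β j := by
    intro ν
    simp only [Interlaces, α, β, ← forall_and, max_le_iff, le_min_iff]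
    exact forall_congr' fun j => by tauto
  have hD : ∀ κ : ℕ →₀ ℕ, (Interlaces κ f ∧ Interlaces κ h) ↔
      ∀ j, α (j + 1) ≤ κ j ∧ κ j ≤ β j := by
    intro κ
    simp only [Interlaces, α, β, ← forall_and, max_le_iff, le_min_iff]
    exact forall_congr' fun j => by tauto
  by_cases hαβ : ∀ j, α (j + 1) ≤ β j
  swap
  · have l0 : ∀ ν, upOp g x f ν * downOp g y ν h = 0 := by
      intro ν
      by_contra h0
      obtain ⟨h1, h2⟩ := mul_ne_zero_iff.1 h0
      have := (hU ν).1 ⟨by_contra fun h' => h1 (if_neg h'), by_contra fun h' => h2 (if_neg h')⟩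
      exact hαβ fun j => (this (j + 1)).1.trans (this j).2
    have r0 : ∀ κ, downOp g y f κ * upOp g x κ h = 0 := by
      intro κ
      by_contra h0
      obtain ⟨h1, h2⟩ := mul_ne_zero_iff.1 h0
      have := (hD κ).1 ⟨by_contra fun h' => h1 (if_neg h'), by_contra fun h' => h2 (if_neg h')⟩
      exact hαβ fun j => (this j).1.trans (this j).2
    simp [l0, r0]
  have hid := sum_upperWeight_eq hq0 hq1 ht0 ht1 N hα hβ hβα hαβ
  let T : (ℕ → ℕ) → ℕ := fun k => ∑ j ∈ Finset.range (N + 1), k j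
  have hTab : T α + T β = T f + T h := by
    simp only [T, ← Finset.sum_add_distrib]
    exact Finset.sum_congr rfl fun j _ => max_add_min _ _
  have hTf : T f ≤ T α := Finset.sum_le_sum fun j _ => le_max_left _ _
  have hTh : T h ≤ T α := Finset.sum_le_sum fun j _ => le_max_right _ _
  have hTf' : T β ≤ T f := Finset.sum_le_sum fun j _ => min_le_left _ _
  have hTh' : T β ≤ T h := Finset.sum_le_sum fun j _ => min_le_right _ _
  have hdf : f.degree = T f := degree_eq_sum_range f fun j hj => hf j (by omega)
  have hdh : h.degree = T h := degree_eq_sum_range h fun j hj => hh j (by omega)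
  let C : ℝ := 1 / (triProd g (N + 1) f (shiftSeq f) * triProd g (N + 1) h h)
  have hC : 0 < C := one_div_pos.2 (mul_pos (htri _ _ _) (htri _ _ _))
  let E : ℝ≥0∞ := x ^ (T α - T f) * y ^ (T α - T h)
  have hL : ∑' ν, upOp g x f ν * downOp g y ν h =
      ∑' R, (∑ ν ∈ upperSet (N + 1) α β R, ENNReal.ofReal (upperWeight g (N + 1) α β ν)) *
        (ENNReal.ofReal C * E * (x * y) ^ R) := by
    refine ENNReal.tsum_eq_tsum_sum_fiber (z := fun R => ENNReal.ofReal C * E * (x * y) ^ R)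
      (fun R ν => mem_upperSet hα hβ R ν) ?_ ?_
    · intro ν hν
      obtain ⟨h1, h2⟩ := (hU ν).2 hν
      have hν0 : ∀ j, N + 1 ≤ j → ν j = 0 := by
        intro j hj
        obtain ⟨i, rfl⟩ : ∃ i, j = i + 1 := ⟨j - 1, by omega⟩
        have := (hν i).2
        rw [hβ i (by omega)] at this
        omega
      rw [upOp, if_pos h1, downOp, if_pos h2,
        (step_eq_aux hg (N := N + 1) (fun j hj => hf j (by omega)) hν0).1,
        (step_eq_aux hg (N := N + 1) (fun j hj => hh j (by omega)) hν0).2]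
      have hsum : T ν = T α + ∑ j ∈ Finset.range (N + 2), (ν j - α j) := by
        rw [Finset.sum_range_succ, hν0 _ le_rfl, Nat.zero_sub, add_zero]
        simp only [T, ← Finset.sum_add_distrib]
        exact Finset.sum_congr rfl fun j _ => (Nat.add_sub_cancel' (hν j).1).symm
      have hdν : ν.degree = T ν := degree_eq_sum_range ν hν0
      generalize ∑ j ∈ Finset.range (N + 2), (ν j - α j) = R at hsum
      have e1 : ν.degree - f.degree = R + (T α - T f) := by omega
      have e2 : ν.degree - h.degree = R + (T α - T h) := by omega
      have e3 : upStepAux g (N + 1) f ν * downStepAux g (N + 1) ν h =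
          upperWeight g (N + 1) α β ν * C := by
        rw [upperWeight_max_min]
        simp only [upStepAux, downStepAux, upperWeight, C]
        have a1 := (htri (N + 1) f (shiftSeq f)).ne'
        have a2 := (htri (N + 1) h h).ne'
        have a3 := (htri (N + 1) ν ν).ne'
        have a4 := (htri (N + 1) ν (shiftSeq ν)).ne'
        field_simp
      have e4 := congrArg ENNReal.ofReal e3
      have hu : 0 ≤ upStepAux g (N + 1) f ν := div_nonneg
        (mul_pos (htri _ _ _) (htri _ _ _)).le (mul_pos (htri _ _ _) (htri _ _ _)).le
      rw [ENNReal.ofReal_mul hu, ENNReal.ofReal_mul' hC.le] at e4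
      rw [e1, e2]
      calc _ = (ENNReal.ofReal (upStepAux g (N + 1) f ν) *
            ENNReal.ofReal (downStepAux g (N + 1) ν h)) *
            (x ^ (R + (T α - T f)) * y ^ (R + (T α - T h))) := by ring
        _ = _ := by
          rw [e4]
          simp only [E]
          ring
    · intro ν hν
      by_contra h0
      obtain ⟨h1, h2⟩ := mul_ne_zero_iff.1 h0
      exact hν ((hU ν).1 ⟨by_contra fun h' => h1 (if_neg h'), by_contra fun h' => h2 (if_neg h')⟩)
  have hR : (∑' k, ENNReal.ofReal (g k 0) * (x * y) ^ k) *
        ∑' κ, downOp g y f κ * upOp g x κ h =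
      ∑' R, (∑ p ∈ lowerSet (N + 1) α β R,
        ENNReal.ofReal (g p.1 0 * lowerWeight g (N + 1) α β p.2)) *
        (ENNReal.ofReal C * E * (x * y) ^ R) := by
    rw [← ENNReal.tsum_mul_right]
    simp only [← ENNReal.tsum_mul_left]
    rw [← ENNReal.tsum_prod (f := fun k κ => ENNReal.ofReal (g k 0) * (x * y) ^ k *
      (downOp g y f κ * upOp g x κ h))]
    refine ENNReal.tsum_eq_tsum_sum_fiber (z := fun R => ENNReal.ofReal C * E * (x * y) ^ R)
      (fun R p => mem_lowerSet (N := N + 1) (fun j hj => hα j (by omega))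
        (fun j hj => hβ j (by omega)) R p) ?_ ?_
    · rintro ⟨k, κ⟩ hκ
      dsimp only at hκ ⊢
      obtain ⟨h1, h2⟩ := (hD κ).2 hκ
      have hκ0 : ∀ j, N + 1 ≤ j → κ j = 0 := by
        intro j hj
        have := (hκ j).2
        rw [hβ j (by omega)] at this
        omega
      rw [upOp, if_pos h2, downOp, if_pos h1,
        (step_eq_aux hg (N := N + 1) hκ0 (fun j hj => hh j (by omega))).1,
        (step_eq_aux hg (N := N + 1) hκ0 (fun j hj => hf j (by omega))).2]
      have hsum : T β = T κ + ∑ j ∈ Finset.range (N + 1), (β j - κ j) := by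
        simp only [T, ← Finset.sum_add_distrib]
        exact Finset.sum_congr rfl fun j _ => (Nat.add_sub_cancel' (hκ j).2).symm
      have hdκ : κ.degree = T κ := degree_eq_sum_range κ hκ0
      generalize ∑ j ∈ Finset.range (N + 1), (β j - κ j) = R at hsum
      have e1 : f.degree - κ.degree = R + (T α - T h) := by omega
      have e2 : h.degree - κ.degree = R + (T α - T f) := by omega
      have e3 : downStepAux g (N + 1) f κ * upStepAux g (N + 1) κ h =
          lowerWeight g (N + 1) α β κ * C := by
        rw [lowerWeight_max_min]
        simp only [upStepAux, downStepAux, lowerWeight, C]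
        have a1 := (htri (N + 1) f (shiftSeq f)).ne'
        have a2 := (htri (N + 1) h h).ne'
        have a3 := (htri (N + 1) κ κ).ne'
        have a4 := (htri (N + 1) κ (shiftSeq κ)).ne'
        field_simp
      have e4 := congrArg ENNReal.ofReal e3
      have hu : 0 ≤ downStepAux g (N + 1) f κ := div_nonneg
        (mul_pos (htri _ _ _) (htri _ _ _)).le (mul_pos (htri _ _ _) (htri _ _ _)).le
      rw [ENNReal.ofReal_mul hu, ENNReal.ofReal_mul' hC.le] at e4
      rw [e1, e2, ENNReal.ofReal_mul (hpos k 0).le]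
      calc _ = ENNReal.ofReal (g k 0) * (x * y) ^ k *
            ((ENNReal.ofReal (downStepAux g (N + 1) f κ) *
            ENNReal.ofReal (upStepAux g (N + 1) κ h)) *
            (y ^ (R + (T α - T h)) * x ^ (R + (T α - T f)))) := by ring
        _ = _ := by
          rw [e4]
          simp only [E]
          ring
    · rintro ⟨k, κ⟩ hκ
      by_contra h0
      obtain ⟨h1, h2⟩ := mul_ne_zero_iff.1 (mul_ne_zero_iff.1 h0).2
      exact hκ ((hD κ).1 ⟨by_contra fun h' => h1 (if_neg h'), by_contra fun h' => h2 (if_neg h')⟩)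
  rw [hL, hR]
  refine tsum_congr fun R => ?_
  rw [← ENNReal.ofReal_sum_of_nonneg, ← ENNReal.ofReal_sum_of_nonneg, hid R]
  · intro p _
    exact mul_nonneg (hpos _ _).le (div_nonneg
      (mul_pos (mul_pos (mul_pos (htri _ _ _) (htri _ _ _)) (htri _ _ _)) (htri _ _ _)).le
      (mul_pos (htri _ _ _) (htri _ _ _)).le)
  · intro p _
    exact div_nonneg
      (mul_pos (mul_pos (mul_pos (htri _ _ _) (htri _ _ _)) (htri _ _ _)) (htri _ _ _)).le
      (mul_pos (htri _ _ _) (htri _ _ _)).le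

/-- The action of a kernel on a row vector. -/
noncomputable def applyKernel {Y : Type*} (T : Y → Y → ℝ≥0∞) (v : Y → ℝ≥0∞) (h : Y) : ℝ≥0∞ :=
  ∑' f, v f * T f h

theorem applyKernel_applyKernel {Y : Type*} (T S : Y → Y → ℝ≥0∞) (v : Y → ℝ≥0∞) (h : Y) :
    applyKernel S (applyKernel T v) h = ∑' f, v f * ∑' ν, T f ν * S ν h := by
  simp only [applyKernel, ← ENNReal.tsum_mul_right, ← ENNReal.tsum_mul_left, mul_assoc]
  exact ENNReal.tsum_comm

theorem applyKernel_const_mul {Y : Type*} (T : Y → Y → ℝ≥0∞) (a : ℝ≥0∞) (v : Y → ℝ≥0∞) :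
    applyKernel T (fun f => a * v f) = fun h => a * applyKernel T v h := by
  funext h
  simp only [applyKernel, ← ENNReal.tsum_mul_left, mul_assoc]

/-- The row vector obtained from the vector supported at `0` by applying kernels in succession. -/
noncomputable def pathVector {Y : Type*} [Zero Y] [DecidableEq Y] (T : ℕ → Y → Y → ℝ≥0∞) :
    ℕ → Y → ℝ≥0∞
  | 0 => Pi.single 0 1
  | n + 1 => applyKernel (T n) (pathVector T n)

theorem applyKernel_single {Y : Type*} [DecidableEq Y] (T : Y → Y → ℝ≥0∞) (a : Y) :
    applyKernel T (Pi.single a 1) = T a := by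
  funext h
  rw [applyKernel, tsum_eq_single a fun b hb => by rw [Pi.single_eq_of_ne hb, zero_mul],
    Pi.single_eq_same, one_mul]

/-- Extend a finite sequence by zero, putting its first term in position `1`. -/
def extendPath {Y : Type*} [Zero Y] {n : ℕ} (L : Fin n → Y) (k : ℕ) : Y :=
  if h : 0 < k ∧ k ≤ n then L ⟨k - 1, by omega⟩ else 0

theorem extendPath_snoc_of_le {Y : Type*} [Zero Y] {n : ℕ} (L : Fin n → Y) (y : Y) {k : ℕ}
    (hk : k ≤ n) : extendPath (Fin.snoc L y : Fin (n + 1) → Y) k = extendPath L k := by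
  unfold extendPath
  by_cases h : 0 < k
  · rw [dif_pos ⟨h, by omega⟩, dif_pos ⟨h, hk⟩]
    have : (⟨k - 1, by omega⟩ : Fin (n + 1)) = Fin.castSucc ⟨k - 1, by omega⟩ := rfl
    rw [this, Fin.snoc_castSucc]
  · rw [dif_neg fun h' => h h'.1, dif_neg fun h' => h h'.1]

theorem extendPath_snoc_last {Y : Type*} [Zero Y] {n : ℕ} (L : Fin n → Y) (y : Y) :
    extendPath (Fin.snoc L y : Fin (n + 1) → Y) (n + 1) = y := by
  unfold extendPath
  rw [dif_pos ⟨by omega, le_rfl⟩]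
  exact Fin.snoc_last (α := fun _ => Y) y L

theorem tsum_pathVector_mul {Y : Type*} [Zero Y] [DecidableEq Y] (T : ℕ → Y → Y → ℝ≥0∞)
    (n : ℕ) (φ : Y → ℝ≥0∞) :
    ∑' h, pathVector T n h * φ h = ∑' L : Fin n → Y,
      (∏ k ∈ Finset.range n, T k (extendPath L k) (extendPath L (k + 1))) *
        φ (extendPath L n) := by
  induction n generalizing φ with
  | zero =>
    rw [tsum_eq_single 0 fun b hb => by rw [pathVector, Pi.single_eq_of_ne hb, zero_mul],
      tsum_eq_single (default : Fin 0 → Y) fun b hb => (hb (Subsingleton.elim _ _)).elim]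
    simp [pathVector, extendPath]
  | succ n ih =>
    have h1 : ∑' h, pathVector T (n + 1) h * φ h =
        ∑' f, pathVector T n f * ∑' h, T n f h * φ h := by
      simp only [pathVector, applyKernel, ← ENNReal.tsum_mul_right, ← ENNReal.tsum_mul_left,
        mul_assoc]
      exact ENNReal.tsum_comm
    rw [h1, ih, ← (Fin.snocEquiv fun _ : Fin (n + 1) => Y).tsum_eq, ENNReal.tsum_prod',
      ENNReal.tsum_comm]
    refine tsum_congr fun L => ?_
    rw [← ENNReal.tsum_mul_left]
    refine tsum_congr fun y => ?_
    change _ = (∏ k ∈ Finset.range (n + 1), T k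
      (extendPath (Fin.snoc L y : Fin (n + 1) → Y) k)
      (extendPath (Fin.snoc L y : Fin (n + 1) → Y) (k + 1))) *
        φ (extendPath (Fin.snoc L y : Fin (n + 1) → Y) (n + 1))
    rw [Finset.prod_range_succ, extendPath_snoc_last, extendPath_snoc_of_le L y le_rfl, mul_assoc]
    congr 1
    refine Finset.prod_congr rfl fun k hk => ?_
    have := Finset.mem_range.1 hk
    rw [extendPath_snoc_of_le L y (by omega), extendPath_snoc_of_le L y (by omega)]

theorem Interlaces.eq_zero {f : ℕ →₀ ℕ} (h : Interlaces f (0 : ℕ →₀ ℕ)) : f = 0 := by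
  ext j
  exact Nat.le_zero.1 (h j).1

theorem upStep_zero_zero {g : ℕ → ℕ → ℝ} (hg : ∀ n m, g n m ≠ 0) :
    upStep g 0 0 = 1 ∧ downStep g 0 0 = 1 := by
  have := step_eq_aux hg (N := 0) (f := 0) (h := 0) (fun _ _ => rfl) fun _ _ => rfl
  rw [this.1, this.2]
  simp [upStepAux, downStepAux, triProd]

theorem upOp_zero {g : ℕ → ℕ → ℝ} (hg : ∀ n m, g n m ≠ 0) (x : ℝ≥0∞) (f : ℕ →₀ ℕ) :
    upOp g x f 0 = if f = 0 then 1 else 0 := by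
  unfold upOp
  by_cases hf : f = 0
  · subst hf
    have : Interlaces (0 : ℕ →₀ ℕ) (0 : ℕ →₀ ℕ) := fun j => ⟨le_rfl, le_rfl⟩
    rw [if_pos this, if_pos rfl, (upStep_zero_zero hg).1]
    simp
  · rw [if_neg fun h => hf h.eq_zero, if_neg hf]

theorem downOp_zero {g : ℕ → ℕ → ℝ} (hg : ∀ n m, g n m ≠ 0) (x : ℝ≥0∞) :
    downOp g x 0 = Pi.single 0 1 := by
  funext f
  unfold downOp
  by_cases hf : f = 0
  · subst hf
    have : Interlaces (0 : ℕ →₀ ℕ) (0 : ℕ →₀ ℕ) := fun j => ⟨le_rfl, le_rfl⟩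
    rw [if_pos this, Pi.single_eq_same, (upStep_zero_zero hg).2]
    simp
  · rw [if_neg fun h => hf h.eq_zero, Pi.single_eq_of_ne hf]

/-- The generating function of the one-row weights. -/
noncomputable def rowSeries (q t : ℝ) (z : ℝ≥0∞) : ℝ≥0∞ :=
  ∑' k, ENNReal.ofReal (fmac q t k 0) * z ^ k

theorem pathVector_downOp {q t : ℝ} (hq0 : 0 ≤ q) (hq1 : q < 1) (ht0 : 0 ≤ t) (ht1 : t < 1)
    (x : ℕ → ℝ≥0∞) (y : ℝ≥0∞) (n : ℕ) {T : ℕ → (ℕ →₀ ℕ) → (ℕ →₀ ℕ) → ℝ≥0∞}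
    (hT : ∀ k < n, T k = upOp (fmac q t) (x k)) :
    applyKernel (downOp (fmac q t) y) (pathVector T n) =
      fun h => (∏ i ∈ Finset.range n, rowSeries q t (x i * y)) * pathVector T n h := by
  have hg : ∀ n m, fmac q t n m ≠ 0 := fun n m => (fmac_pos hq0 hq1 ht0 ht1 n m).ne'
  induction n with
  | zero =>
    rw [pathVector, applyKernel_single, downOp_zero hg]
    simp
  | succ n ih =>
    have ih' := ih fun k hk => hT k (by omega)
    funext h
    rw [pathVector, applyKernel_applyKernel, hT n (by omega)]
    simp only [tsum_upOp_mul_downOp hq0 hq1 ht0 ht1]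
    have := applyKernel_applyKernel (downOp (fmac q t) y) (upOp (fmac q t) (x n))
      (pathVector T n) h
    rw [ih', applyKernel_const_mul] at this
    simp only [mul_left_comm _ (∑' k, _ * _ ^ k) _, ENNReal.tsum_mul_left]
    rw [← this, Finset.prod_range_succ, rowSeries]
    ring

theorem pathVector_up_zero {q t : ℝ} (hq0 : 0 ≤ q) (hq1 : q < 1) (ht0 : 0 ≤ t) (ht1 : t < 1)
    (x : ℕ → ℝ≥0∞) (n : ℕ) {T : ℕ → (ℕ →₀ ℕ) → (ℕ →₀ ℕ) → ℝ≥0∞}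
    (hT : ∀ k < n, T k = upOp (fmac q t) (x k)) : pathVector T n 0 = 1 := by
  have hg : ∀ n m, fmac q t n m ≠ 0 := fun n m => (fmac_pos hq0 hq1 ht0 ht1 n m).ne'
  induction n with
  | zero => simp [pathVector]
  | succ n ih =>
    rw [pathVector, hT n (by omega), applyKernel, tsum_eq_single 0, upOp_zero hg, if_pos rfl,
      mul_one]
    · exact ih fun k hk => hT k (by omega)
    · intro f hf
      rw [upOp_zero hg, if_neg hf, mul_zero]

/-- The kernels adding strips for `r` steps and removing strips afterwards. -/
noncomputable def upDownKernel (q t : ℝ) (x y : ℕ → ℝ≥0∞) (r k : ℕ) :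
    (ℕ →₀ ℕ) → (ℕ →₀ ℕ) → ℝ≥0∞ :=
  if k < r then upOp (fmac q t) (x k) else downOp (fmac q t) (y (k - r))

theorem pathVector_upDownKernel {q t : ℝ} (hq0 : 0 ≤ q) (hq1 : q < 1) (ht0 : 0 ≤ t)
    (ht1 : t < 1) (x y : ℕ → ℝ≥0∞) (r c : ℕ) :
    pathVector (upDownKernel q t x y r) (r + c) =
      fun h => (∏ j ∈ Finset.range c, ∏ i ∈ Finset.range r, rowSeries q t (x i * y j)) *
        pathVector (upDownKernel q t x y r) r h := by
  induction c with
  | zero => simp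
  | succ c ih =>
    have h1 : upDownKernel q t x y r (r + c) = downOp (fmac q t) (y c) := by
      rw [upDownKernel, if_neg (by omega), Nat.add_sub_cancel_left]
    rw [← add_assoc, pathVector, ih, h1, applyKernel_const_mul,
      pathVector_downOp hq0 hq1 ht0 ht1 x (y c) r fun k hk => by rw [upDownKernel, if_pos hk]]
    funext h
    rw [Finset.prod_range_succ, mul_assoc]

theorem tsum_prod_upDownKernel {q t : ℝ} (hq0 : 0 ≤ q) (hq1 : q < 1) (ht0 : 0 ≤ t)
    (ht1 : t < 1) (x y : ℕ → ℝ≥0∞) (r c : ℕ) :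
    ∑' L : Fin (r + c) → (ℕ →₀ ℕ), (∏ k ∈ Finset.range (r + c),
        upDownKernel q t x y r k (extendPath L k) (extendPath L (k + 1))) *
        (if extendPath L (r + c) = 0 then 1 else 0) =
      ∏ i ∈ Finset.range r, ∏ j ∈ Finset.range c, rowSeries q t (x i * y j) := by
  have h0 := congrFun (pathVector_upDownKernel hq0 hq1 ht0 ht1 x y r c) 0
  have h1 := pathVector_up_zero hq0 hq1 ht0 ht1 x r (T := upDownKernel q t x y r)
    fun k hk => if_pos hk
  simp only [h1, mul_one] at h0
  rw [← tsum_pathVector_mul (upDownKernel q t x y r) (r + c) fun h => if h = 0 then 1 else 0,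
    tsum_eq_single 0 fun f hf => by rw [if_neg hf, mul_zero], if_pos rfl, mul_one, h0,
    Finset.prod_comm]

theorem tendsto_prod_qPoch {q : ℝ} (hq0 : 0 ≤ q) (hq1 : q < 1) (x : ℝ) :
    Filter.Tendsto (fun N => ∏ n ∈ Finset.range N, (1 - x * q ^ n)) Filter.atTop
      (nhds (qPoch x q)) := by
  have h1 : Summable fun n : ℕ => ‖-(x * q ^ n)‖ :=
    ((summable_geometric_of_lt_one hq0 hq1).mul_left x).neg.norm
  have := (multipliable_one_add_of_summable h1).hasProd.tendsto_prod_nat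
  simpa only [← sub_eq_add_neg, qPoch] using this

theorem summable_fmac_mul_pow {q t z : ℝ} (hq0 : 0 ≤ q) (hq1 : q < 1) (ht0 : 0 ≤ t) (ht1 : t < 1)
    (hz0 : 0 ≤ z) (hz1 : z < 1) : Summable fun k => fmac q t k 0 * z ^ k := by
  rcases hz0.eq_or_lt with rfl | hz0
  · refine summable_of_ne_finset_zero (s := {0}) fun k hk => ?_
    rw [zero_pow (by simpa using hk), mul_zero]
  have hp := fun k => mul_pos (fmac_pos hq0 hq1 ht0 ht1 k 0) (pow_pos hz0 k)
  refine summable_of_ratio_test_tendsto_lt_one (l := 1 * z) (by simpa using hz1)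
    (Filter.Eventually.of_forall fun k => (hp k).ne') ?_
  refine ((tendsto_fmac_ratio hq0 hq1 ht0 ht1 0).mul_const z).congr fun k => ?_
  rw [Real.norm_of_nonneg (hp _).le, Real.norm_of_nonneg (hp _).le]
  have := (fmac_pos hq0 hq1 ht0 ht1 k 0).ne'
  field_simp
  ring

theorem one_sub_mul_tsum_fmac {q t z : ℝ} (hq0 : 0 ≤ q) (hq1 : q < 1) (ht0 : 0 ≤ t) (ht1 : t < 1)
    (hz0 : 0 ≤ z) (hz1 : z < 1) :
    (1 - z) * ∑' k, fmac q t k 0 * z ^ k =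
      (1 - t * z) * ∑' k, fmac q t k 0 * (q * z) ^ k := by
  have s1 := summable_fmac_mul_pow hq0 hq1 ht0 ht1 hz0 hz1
  have s2 := summable_fmac_mul_pow hq0 hq1 ht0 ht1 (mul_nonneg hq0 hz0)
    (mul_lt_one_of_nonneg_of_lt_one_left hq0 hq1 hz1.le)
  have s1' := (summable_nat_add_iff 1).2 s1
  have s2' := (summable_nat_add_iff 1).2 s2
  have e1 := s1.tsum_eq_zero_add
  have e2 := s2.tsum_eq_zero_add
  have key : ∑' k, fmac q t (k + 1) 0 * z ^ (k + 1) - ∑' k, fmac q t (k + 1) 0 * (q * z) ^ (k + 1)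
      = z * ∑' k, fmac q t k 0 * z ^ k - t * z * ∑' k, fmac q t k 0 * (q * z) ^ k := by
    rw [← s1'.tsum_sub s2', ← tsum_mul_left, ← tsum_mul_left,
      ← (s1.mul_left _).tsum_sub (s2.mul_left _)]
    refine tsum_congr fun k => ?_
    have h := (one_sub_pow_mul_pow_pos hq0 hq1 ht0 ht1 (a := k + 1) (b := 0)
      (Or.inl k.succ_ne_zero)).ne'
    rw [fmac_succ]
    simp only [pow_zero, mul_one, zero_add, pow_one] at h ⊢
    field_simp
    ring
  simp only [pow_zero, mul_one] at e1 e2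
  linear_combination e1 - e2 + key

theorem tsum_fmac_mul_qPoch {q t z : ℝ} (hq0 : 0 ≤ q) (hq1 : q < 1) (ht0 : 0 ≤ t) (ht1 : t < 1)
    (hz0 : 0 ≤ z) (hz1 : z < 1) :
    qPoch z q * ∑' k, fmac q t k 0 * z ^ k = qPoch (t * z) q := by
  have hz : ∀ N : ℕ, 0 ≤ q ^ N * z ∧ q ^ N * z ≤ z := fun N =>
    ⟨mul_nonneg (pow_nonneg hq0 N) hz0, mul_le_of_le_one_left hz0 (pow_le_one₀ hq0 hq1.le)⟩
  have iter : ∀ N : ℕ, (∏ n ∈ Finset.range N, (1 - z * q ^ n)) * ∑' k, fmac q t k 0 * z ^ k =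
      (∏ n ∈ Finset.range N, (1 - t * z * q ^ n)) * ∑' k, fmac q t k 0 * (q ^ N * z) ^ k := by
    intro N
    induction N with
    | zero => simp
    | succ N ih =>
      have := one_sub_mul_tsum_fmac hq0 hq1 ht0 ht1 (hz N).1 ((hz N).2.trans_lt hz1)
      rw [← mul_assoc q, ← pow_succ'] at this
      rw [Finset.prod_range_succ, Finset.prod_range_succ]
      linear_combination (1 - z * q ^ N) * ih +
        (∏ n ∈ Finset.range N, (1 - t * z * q ^ n)) * this
  have hlim : Filter.Tendsto (fun N : ℕ => ∑' k, fmac q t k 0 * (q ^ N * z) ^ k) Filter.atTop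
      (nhds (∑' k, fmac q t k 0 * (0 * z) ^ k)) := by
    refine tendsto_tsum_of_dominated_convergence
      (summable_fmac_mul_pow hq0 hq1 ht0 ht1 hz0 hz1) (fun k => ?_)
      (Filter.Eventually.of_forall fun N k => ?_)
    · exact (((tendsto_pow_atTop_nhds_zero_of_lt_one hq0 hq1).mul_const z).pow k).const_mul _
    · have := (fmac_pos hq0 hq1 ht0 ht1 k 0).le
      rw [Real.norm_of_nonneg (mul_nonneg this (pow_nonneg (hz N).1 k))]
      exact mul_le_mul_of_nonneg_left (pow_le_pow_left₀ (hz N).1 (hz N).2 k) this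
  have h0 : ∑' k, fmac q t k 0 * (0 * z) ^ k = 1 := by
    rw [tsum_eq_single 0 fun k hk => by rw [zero_mul, zero_pow hk, mul_zero]]
    simp [fmac_zero]
  rw [h0] at hlim
  have := (tendsto_prod_qPoch hq0 hq1 (t * z)).mul hlim
  rw [mul_one] at this
  exact tendsto_nhds_unique (((tendsto_prod_qPoch hq0 hq1 z).mul_const _).congr iter) this

/-- The `q`-binomial theorem. -/
theorem tsum_fmac_mul_pow {q t z : ℝ} (hq0 : 0 ≤ q) (hq1 : q < 1) (ht0 : 0 ≤ t) (ht1 : t < 1)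
    (hz0 : 0 ≤ z) (hz1 : z < 1) :
    ∑' k, fmac q t k 0 * z ^ k = qPoch (t * z) q / qPoch z q := by
  have h1 : qPoch z q ≠ 0 := by
    intro h
    have := tsum_fmac_mul_qPoch hq0 hq1 le_rfl zero_lt_one hz0 hz1
    rw [h, zero_mul, zero_mul] at this
    simp [qPoch] at this
  rw [eq_div_iff h1, mul_comm, tsum_fmac_mul_qPoch hq0 hq1 ht0 ht1 hz0 hz1]

theorem rowSeries_ofReal {q t z : ℝ} (hq0 : 0 ≤ q) (hq1 : q < 1) (ht0 : 0 ≤ t) (ht1 : t < 1)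
    (hz0 : 0 ≤ z) (hz1 : z < 1) :
    (rowSeries q t (ENNReal.ofReal z)).toReal = qPoch (t * z) q / qPoch z q := by
  have hp := fun k => mul_nonneg (fmac_pos hq0 hq1 ht0 ht1 k 0).le (pow_nonneg hz0 k)
  rw [← tsum_fmac_mul_pow hq0 hq1 ht0 ht1 hz0 hz1, rowSeries,
    ← ENNReal.toReal_ofReal (tsum_nonneg hp),
    ENNReal.ofReal_tsum_of_nonneg hp (summable_fmac_mul_pow hq0 hq1 ht0 ht1 hz0 hz1)]
  congr 2
  funext k
  rw [ENNReal.ofReal_mul (fmac_pos hq0 hq1 ht0 ht1 k 0).le, ENNReal.ofReal_pow hz0]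

theorem triProd_eq_prod_sub {K : Type*} [CommMonoid K] (g : ℕ → ℕ → K) (N : ℕ) (f h : ℕ → ℕ) :
    triProd g N f h =
      ∏ a ∈ Finset.range N, ∏ m ∈ Finset.range (N - a), g (f a - h (a + m)) m := by
  refine Finset.prod_congr rfl fun a _ => ?_
  rw [← Finset.prod_filter]
  have : (Finset.range N).filter (fun j => a ≤ j) = Finset.Ico a N := by
    ext j
    simp [and_comm]
  rw [this, Finset.prod_Ico_eq_prod_range]
  exact Finset.prod_congr rfl fun m _ => by rw [Nat.add_sub_cancel_left]

theorem triProd_zero_left {K : Type*} [CommMonoid K] {g : ℕ → ℕ → K} (hg : ∀ m, g 0 m = 1)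
    (N : ℕ) {f : ℕ → ℕ} (hf : ∀ j, f j = 0) (h : ℕ → ℕ) : triProd g N f h = 1 := by
  refine Finset.prod_eq_one fun i _ => Finset.prod_eq_one fun j _ => ?_
  rw [hf, Nat.zero_sub, hg, ite_self]

/-- Reindexing the boxes of a rectangle by diagonals. -/
@[to_additive]
theorem prod_diagonals {M : Type*} [CommMonoid M] (F : ℕ → ℕ → M) {r c N : ℕ} (hr : r ≤ N)
    (hF : ∀ i j, r ≤ i ∨ c ≤ j → F i j = 1) :
    ∏ p ∈ Finset.range r ×ˢ Finset.range c, F p.1 p.2 =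
      ∏ k ∈ Finset.range (r + c), ∏ a ∈ Finset.range N, F (a + (r - (k + 1))) (a + (k + 1 - r)) := by
  rw [← Finset.prod_product']
  refine Finset.prod_of_injOn (fun p => (p.2 + r - p.1 - 1, min p.1 p.2)) ?_ ?_ ?_ ?_
  · rintro ⟨i, j⟩ h1 ⟨i', j'⟩ h2 h
    simp only [Finset.coe_product, Finset.coe_range, Set.mem_prod, Set.mem_Iio, Prod.mk.injEq]
      at h1 h2 h ⊢
    omega
  · rintro ⟨i, j⟩ h1
    simp only [Finset.coe_product, Finset.coe_range, Set.mem_prod, Set.mem_Iio] at h1 ⊢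
    omega
  · rintro ⟨k, a⟩ h1 h2
    refine hF _ _ ?_
    by_contra h
    refine h2 ⟨(a + (r - (k + 1)), a + (k + 1 - r)), ?_, ?_⟩
    · simp only [Finset.coe_product, Finset.coe_range, Set.mem_prod, Set.mem_Iio]
      omega
    · simp only [Prod.mk.injEq]
      omega
  · rintro ⟨i, j⟩ h1
    simp only [Finset.mem_product, Finset.mem_range] at h1
    have e1 : min i j + (r - (j + r - i - 1 + 1)) = i := by omega
    have e2 : min i j + (j + r - i - 1 + 1 - r) = j := by omega
    simp only [e1, e2]

namespace PlanePartition

/-- The diagonals of a plane partition, numbered so that the main one has number `r`. -/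
noncomputable def diagonal (π : PlanePartition) (r k : ℕ) : ℕ →₀ ℕ :=
  Finsupp.ofSupportFinite (fun a => π.part (a + (r - k)) (a + (k - r))) <| by
    refine (π.finite_supp.preimage (f := fun a => (a + (r - k), a + (k - r))) ?_).subset
      fun a ha => ha
    intro a _ b _ hab
    simp only [Prod.mk.injEq] at hab
    omega

theorem diagonal_apply (π : PlanePartition) (r k a : ℕ) :
    π.diagonal r k a = π.part (a + (r - k)) (a + (k - r)) := rfl

theorem interlaces_diagonal_up (π : PlanePartition) {r k : ℕ} (hk : k < r) :
    Interlaces (π.diagonal r k) (π.diagonal r (k + 1)) := by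
  intro j
  simp only [diagonal_apply]
  have e1 : k - r = 0 := by omega
  have e2 : k + 1 - r = 0 := by omega
  obtain ⟨d, rfl⟩ := Nat.exists_eq_add_of_lt hk
  have e3 : k + d + 1 - k = d + 1 := by omega
  have e4 : k + d + 1 - (k + 1) = d := by omega
  rw [e1, e2, e3, e4]
  refine ⟨π.col_decr _ _, ?_⟩
  have := π.row_decr (j + (d + 1)) j
  rwa [show j + 1 + d = j + (d + 1) by omega]

theorem interlaces_diagonal_down (π : PlanePartition) {r k : ℕ} (hk : r ≤ k) :
    Interlaces (π.diagonal r (k + 1)) (π.diagonal r k) := by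
  intro j
  simp only [diagonal_apply]
  obtain ⟨d, rfl⟩ := Nat.exists_eq_add_of_le hk
  have e1 : r - (r + d) = 0 := by omega
  have e2 : r - (r + d + 1) = 0 := by omega
  have e3 : r + d - r = d := by omega
  have e4 : r + d + 1 - r = d + 1 := by omega
  rw [e1, e2, e3, e4]
  refine ⟨π.row_decr _ _, ?_⟩
  have := π.col_decr j (j + (d + 1))
  rwa [show j + 1 + d = j + (d + 1) by omega]

variable {π : PlanePartition} {r c : ℕ}

theorem diagonal_eq_zero (hπ : ∀ i j, r ≤ i ∨ c ≤ j → π.part i j = 0) {k : ℕ}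
    (hk : k = 0 ∨ r + c ≤ k) : π.diagonal r k = 0 := by
  ext a
  rw [diagonal_apply, Finsupp.zero_apply]
  exact hπ _ _ (by omega)

theorem diagonal_apply_eq_zero (hπ : ∀ i j, r ≤ i ∨ c ≤ j → π.part i j = 0) (k : ℕ) {a : ℕ}
    (ha : r ≤ a) : π.diagonal r k a = 0 :=
  hπ _ _ (Or.inl (by omega))

theorem weight_eq_sum_degree (hπ : ∀ i j, r ≤ i ∨ c ≤ j → π.part i j = 0) :
    π.weight = ∑ k ∈ Finset.range (r + c), (π.diagonal r (k + 1)).degree := by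
  have h1 : π.weight = ∑ p ∈ Finset.range r ×ˢ Finset.range c, π.part p.1 p.2 := by
    refine finsum_eq_sum_of_support_subset _ fun p hp => ?_
    simp only [Finset.coe_product, Finset.coe_range, Set.mem_prod, Set.mem_Iio]
    by_contra h
    exact hp (hπ _ _ (by omega))
  rw [h1, sum_diagonals π.part le_rfl hπ]
  refine Finset.sum_congr rfl fun k _ => ?_
  rw [degree_eq_sum_range _ fun j hj => diagonal_apply_eq_zero hπ (k + 1) hj]
  rfl

/-- The lower neighbours of a diagonal. -/
noncomputable def lowerNeighbour (π : PlanePartition) (r k : ℕ) : ℕ → ℕ :=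
  if k < r then π.diagonal r k else shiftSeq (π.diagonal r k)

/-- The right neighbours of a diagonal. -/
noncomputable def rightNeighbour (π : PlanePartition) (r k : ℕ) : ℕ → ℕ :=
  if k < r then shiftSeq (π.diagonal r (k + 1)) else π.diagonal r (k + 1)

theorem lowerNeighbour_apply (π : PlanePartition) (r k b : ℕ) :
    π.lowerNeighbour r k b = π.part (b + (r - (k + 1)) + 1) (b + (k + 1 - r)) := by
  unfold lowerNeighbour
  split_ifs with h
  · rw [diagonal_apply]
    congr 1 <;> omega
  · rw [shiftSeq, diagonal_apply]
    congr 1 <;> omega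

theorem rightNeighbour_apply (π : PlanePartition) (r k b : ℕ) :
    π.rightNeighbour r k b = π.part (b + (r - k)) (b + (k - r) + 1) := by
  unfold rightNeighbour
  split_ifs with h
  · rw [shiftSeq, diagonal_apply]
    congr 1 <;> omega
  · rw [diagonal_apply]
    congr 1 <;> omega

variable {q t : ℝ}

theorem Fbox_eq_prod (hg : ∀ n m, fmac q t n m ≠ 0)
    (hπ : ∀ i j, r ≤ i ∨ c ≤ j → π.part i j = 0) (k : ℕ) {a N : ℕ} (hN : r ≤ N) :
    Fbox q t π (a + (r - (k + 1))) (a + (k + 1 - r)) = ∏ m ∈ Finset.range (N - a),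
      (fmac q t (π.diagonal r (k + 1) a - π.lowerNeighbour r k (a + m)) m *
          fmac q t (π.diagonal r (k + 1) a - π.rightNeighbour r (k + 1) (a + m)) m) /
        (fmac q t (π.diagonal r (k + 1) a - π.diagonal r (k + 1) (a + m)) m *
          fmac q t (π.diagonal r (k + 1) a - shiftSeq (π.diagonal r (k + 1)) (a + m)) m) := by
  rw [Fbox, tprod_eq_prod (s := Finset.range (N - a))]
  · refine Finset.prod_congr rfl fun m _ => ?_
    have e1 : a + m + (r - (k + 1)) = a + (r - (k + 1)) + m := Nat.add_right_comm _ _ _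
    have e2 : a + m + (k + 1 - r) = a + (k + 1 - r) + m := Nat.add_right_comm _ _ _
    have e3 : a + m + 1 + (r - (k + 1)) = a + (r - (k + 1)) + m + 1 := by omega
    have e4 : a + m + 1 + (k + 1 - r) = a + (k + 1 - r) + m + 1 := by omega
    simp only [lowerNeighbour_apply, rightNeighbour_apply, diagonal_apply, shiftSeq, e1, e2, e3,
      e4, Nat.add_right_comm _ 1 m]
  · intro m hm
    rw [Finset.mem_range] at hm
    rw [hπ _ _ (Or.inl (show r ≤ a + (r - (k + 1)) + 1 + m by omega)),
      hπ _ _ (Or.inl (show r ≤ a + (r - (k + 1)) + m by omega)),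
      hπ _ _ (Or.inl (show r ≤ a + (r - (k + 1)) + m by omega)),
      hπ _ _ (Or.inl (show r ≤ a + (r - (k + 1)) + m + 1 by omega))]
    exact div_self (mul_ne_zero (hg _ _) (hg _ _))

theorem prod_Fbox_diagonal (hg : ∀ n m, fmac q t n m ≠ 0)
    (hπ : ∀ i j, r ≤ i ∨ c ≤ j → π.part i j = 0) (k : ℕ) {N : ℕ} (hN : r ≤ N) :
    ∏ a ∈ Finset.range N, Fbox q t π (a + (r - (k + 1))) (a + (k + 1 - r)) =
      triProd (fmac q t) N (π.diagonal r (k + 1)) (π.lowerNeighbour r k) /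
          triProd (fmac q t) N (π.diagonal r (k + 1)) (π.diagonal r (k + 1)) *
        (triProd (fmac q t) N (π.diagonal r (k + 1)) (π.rightNeighbour r (k + 1)) /
          triProd (fmac q t) N (π.diagonal r (k + 1)) (shiftSeq (π.diagonal r (k + 1)))) := by
  simp only [triProd_eq_prod_sub, ← Finset.prod_div_distrib, ← Finset.prod_mul_distrib]
  refine Finset.prod_congr rfl fun a _ => ?_
  rw [Fbox_eq_prod hg hπ k hN]
  exact Finset.prod_congr rfl fun m _ => mul_div_mul_comm _ _ _ _

theorem Fbox_eq_one {i j : ℕ} (h : π.part i j = 0) :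
    Fbox q t π i j = 1 := by
  simp [Fbox, h, fmac_zero]

theorem Fmac_eq_prod
    (hπ : ∀ i j, r ≤ i ∨ c ≤ j → π.part i j = 0) :
    Fmac q t π = ∏ p ∈ Finset.range r ×ˢ Finset.range c, Fbox q t π p.1 p.2 := by
  have h1 : (fun p : ℕ × ℕ => if π.part p.1 p.2 ≠ 0 then Fbox q t π p.1 p.2 else 1) =
      fun p => Fbox q t π p.1 p.2 := by
    funext p
    split_ifs with h
    · rfl
    · exact (Fbox_eq_one (not_not.1 h)).symm
  rw [Fmac, h1]
  refine finprod_eq_prod_of_mulSupport_subset _ fun p hp => ?_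
  simp only [Finset.coe_product, Finset.coe_range, Set.mem_prod, Set.mem_Iio]
  by_contra h
  exact hp (Fbox_eq_one (hπ _ _ (by omega)))

/-- The weight of the step between two consecutive diagonals. -/
noncomputable def stepWeight (q t : ℝ) (π : PlanePartition) (r k : ℕ) : ℝ :=
  if k < r then upStep (fmac q t) (π.diagonal r k) (π.diagonal r (k + 1))
  else downStep (fmac q t) (π.diagonal r k) (π.diagonal r (k + 1))

theorem stepWeight_eq (hg : ∀ n m, fmac q t n m ≠ 0)
    (hπ : ∀ i j, r ≤ i ∨ c ≤ j → π.part i j = 0) (k : ℕ) :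
    stepWeight q t π r k =
      triProd (fmac q t) r (π.diagonal r (k + 1)) (π.lowerNeighbour r k) /
          triProd (fmac q t) r (π.diagonal r (k + 1)) (π.diagonal r (k + 1)) *
        (triProd (fmac q t) r (π.diagonal r k) (π.rightNeighbour r k) /
          triProd (fmac q t) r (π.diagonal r k) (shiftSeq (π.diagonal r k))) := by
  have h := fun k => fun j (hj : r ≤ j) => diagonal_apply_eq_zero hπ k hj
  rw [← mul_div_mul_comm]
  unfold stepWeight lowerNeighbour rightNeighbour
  split_ifs with hk
  · rw [(step_eq_aux hg (h k) (h (k + 1))).1, upStepAux,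
      mul_comm (triProd _ _ (π.diagonal r k) (shiftSeq (π.diagonal r k)))]
  · rw [(step_eq_aux hg (h (k + 1)) (h k)).2, downStepAux,
      mul_comm (triProd _ _ (π.diagonal r k) (π.diagonal r (k + 1))),
      mul_comm (triProd _ _ (π.diagonal r k) (shiftSeq (π.diagonal r k)))]

theorem Fmac_eq_prod_stepWeight (hg : ∀ n m, fmac q t n m ≠ 0)
    (hπ : ∀ i j, r ≤ i ∨ c ≤ j → π.part i j = 0) :
    Fmac q t π = ∏ k ∈ Finset.range (r + c), stepWeight q t π r k := by
  rw [Fmac_eq_prod hπ, prod_diagonals (Fbox q t π) le_rfl fun i j h => Fbox_eq_one (hπ i j h)]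
  simp only [prod_Fbox_diagonal hg hπ _ le_rfl, stepWeight_eq hg hπ]
  rw [Finset.prod_mul_distrib, Finset.prod_mul_distrib]
  congr 1
  set R : ℕ → ℝ := fun k => triProd (fmac q t) r (π.diagonal r k) (π.rightNeighbour r k) /
    triProd (fmac q t) r (π.diagonal r k) (shiftSeq (π.diagonal r k)) with hR
  have hR1 : ∀ k, k = 0 ∨ r + c ≤ k → R k = 1 := by
    intro k hk
    have h0 : ∀ j, π.diagonal r k j = 0 := fun j => by rw [diagonal_eq_zero hπ hk]; rfl
    rw [hR]
    simp only [triProd_zero_left (fmac_zero q t) r h0, div_one]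
  have e1 := Finset.prod_range_succ R (r + c)
  rw [Finset.prod_range_succ', hR1 0 (Or.inl rfl), hR1 (r + c) (Or.inr le_rfl)] at e1
  rw [mul_one, mul_one] at e1
  exact e1

end PlanePartition

theorem sum_sub_mul_sub {d : ℕ → ℕ} (h0 : d 0 = 0) {m : ℕ} (hd : ∀ k < m, d k ≤ d (k + 1)) :
    ∑ k ∈ Finset.range m, (m - k) * (d (k + 1) - d k) = ∑ k ∈ Finset.range m, d (k + 1) := by
  have tel : ∀ n ≤ m, ∑ k ∈ Finset.range n, (d (k + 1) - d k) = d n := by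
    intro n hn
    induction n with
    | zero => simp [h0]
    | succ n ih =>
      rw [Finset.sum_range_succ, ih (by omega)]
      have := hd n hn
      omega
  induction m with
  | zero => rfl
  | succ m ih =>
    have h1 := tel (m + 1) le_rfl
    rw [Finset.sum_range_succ] at h1
    have h2 : ∑ k ∈ Finset.range m, (m + 1 - k) * (d (k + 1) - d k) =
        ∑ k ∈ Finset.range m, (m - k) * (d (k + 1) - d k) +
          ∑ k ∈ Finset.range m, (d (k + 1) - d k) := by
      rw [← Finset.sum_add_distrib]
      refine Finset.sum_congr rfl fun k hk => ?_
      have := Finset.mem_range.1 hk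
      rw [Nat.sub_add_comm (by omega), add_one_mul]
    rw [Finset.sum_range_succ, Finset.sum_range_succ, h2,
      ih (fun k hk => hd k (by omega)) fun n hn => tel n (by omega), add_assoc,
      Nat.add_sub_cancel_left, one_mul, h1]

theorem sum_mul_sub_add_mul {e : ℕ → ℕ} {c : ℕ} (he : ∀ j < c, e (j + 1) ≤ e j) :
    ∑ j ∈ Finset.range c, j * (e j - e (j + 1)) + c * e c = ∑ j ∈ Finset.range c, e (j + 1) := by
  induction c with
  | zero => simp
  | succ c ih =>
    rw [Finset.sum_range_succ, Finset.sum_range_succ, ← ih fun j hj => he j (by omega)]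
    obtain ⟨w, hw⟩ := Nat.exists_eq_add_of_le (he c (by omega))
    rw [hw, Nat.add_sub_cancel_left]
    ring

theorem Interlaces.degree_le {f h : ℕ →₀ ℕ} (hfh : Interlaces f h) : f.degree ≤ h.degree := by
  have hf := fun j (hj : max (lengthBound f) (lengthBound h) ≤ j) =>
    eq_zero_of_lengthBound_le f ((le_max_left _ _).trans hj)
  have hh := fun j (hj : max (lengthBound f) (lengthBound h) ≤ j) =>
    eq_zero_of_lengthBound_le h ((le_max_right _ _).trans hj)
  rw [degree_eq_sum_range f hf, degree_eq_sum_range h hh]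
  exact Finset.sum_le_sum fun j _ => (hfh j).1

theorem step_pos {q t : ℝ} (hq0 : 0 ≤ q) (hq1 : q < 1) (ht0 : 0 ≤ t) (ht1 : t < 1)
    (f h : ℕ →₀ ℕ) : 0 < upStep (fmac q t) f h ∧ 0 < downStep (fmac q t) f h := by
  have p := fun N f h => triProd_fmac_pos hq0 hq1 ht0 ht1 N f h
  constructor
  · exact div_pos (mul_pos (p _ _ _) (p _ _ _)) (mul_pos (p _ _ _) (p _ _ _))
  · exact div_pos (mul_pos (p _ _ _) (p _ _ _)) (mul_pos (p _ _ _) (p _ _ _))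

namespace PlanePartition

variable {r c : ℕ}

/-- A chain of interlacing partitions is the chain of diagonals of a plane partition. -/
theorem exists_diagonal_eq {E : ℕ → ℕ →₀ ℕ} (h0 : E 0 = 0) (hn : ∀ k, r + c ≤ k → E k = 0)
    (hup : ∀ k < r, Interlaces (E k) (E (k + 1)))
    (hdown : ∀ k, r ≤ k → Interlaces (E (k + 1)) (E k)) :
    ∃ π : PlanePartition, (∀ i j, r ≤ i ∨ c ≤ j → π.part i j = 0) ∧
      ∀ k, π.diagonal r k = E k := by
  have row : ∀ i j, E (j + 1 + r - i) (min i (j + 1)) ≤ E (j + r - i) (min i j) := by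
    intro i j
    rcases lt_or_ge (j + r) i with h | h
    · rw [show j + 1 + r - i = 0 by omega, h0]
      exact Nat.zero_le _
    rw [show j + 1 + r - i = j + r - i + 1 by omega]
    rcases le_or_gt i j with hij | hij
    · rw [show min i (j + 1) = min i j by omega]
      exact (hdown _ (by omega) _).1
    · rw [show min i (j + 1) = min i j + 1 by omega]
      exact (hup _ (by omega) _).2
  have col : ∀ i j, E (j + r - (i + 1)) (min (i + 1) j) ≤ E (j + r - i) (min i j) := by
    intro i j
    rcases le_or_gt (j + r) i with h | h
    · rw [show j + r - (i + 1) = 0 by omega, h0]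
      exact Nat.zero_le _
    rw [show j + r - i = j + r - (i + 1) + 1 by omega]
    rcases lt_or_ge i j with hij | hij
    · rw [show min (i + 1) j = min i j + 1 by omega]
      exact (hdown _ (by omega) _).2
    · rw [show min (i + 1) j = min i j by omega]
      exact (hup _ (by omega) _).1
  have hz : ∀ i j, r ≤ i ∨ c ≤ j → E (j + r - i) (min i j) = 0 := by
    rintro i j (h | h)
    · have h1 : E (j + r - i) (min i j) ≤ E (0 + r - i) (min i 0) :=
        antitone_nat_of_succ_le (f := fun j => E (j + r - i) (min i j)) (row i) (Nat.zero_le j)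
      rw [show 0 + r - i = 0 by omega, h0] at h1
      exact Nat.le_zero.1 h1
    · have h1 : E (j + r - i) (min i j) ≤ E (j + r - 0) (min 0 j) :=
        antitone_nat_of_succ_le (f := fun i => E (j + r - i) (min i j)) (fun i => col i j)
          (Nat.zero_le i)
      rw [hn (j + r - 0) (by omega)] at h1
      exact Nat.le_zero.1 h1
  refine ⟨⟨fun i j => E (j + r - i) (min i j), row, col, ?_⟩, hz, fun k => ?_⟩
  · refine (Finset.range r ×ˢ Finset.range c).finite_toSet.subset fun p hp => ?_
    simp only [Finset.coe_product, Finset.coe_range, Set.mem_prod, Set.mem_Iio]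
    by_contra h
    exact hp (hz _ _ (by omega))
  · ext a
    rw [diagonal_apply]
    change E (a + (k - r) + r - (a + (r - k))) (min (a + (r - k)) (a + (k - r))) = E k a
    rw [show a + (k - r) + r - (a + (r - k)) = k by omega,
      show min (a + (r - k)) (a + (k - r)) = a by omega]

/-- The chain of diagonals of a boxed plane partition. -/
noncomputable def diagonalChain (r c : ℕ) (π : PlanePartition) : Fin (r + c) → (ℕ →₀ ℕ) :=
  fun k => π.diagonal r (k + 1)

theorem extendPath_diagonalChain {π : PlanePartition}
    (hπ : ∀ i j, r ≤ i ∨ c ≤ j → π.part i j = 0) (k : ℕ) :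
    extendPath (diagonalChain r c π) k = π.diagonal r k := by
  unfold extendPath
  split_ifs with h
  · simp only [diagonalChain]
    rw [Nat.sub_add_cancel h.1]
  · exact (diagonal_eq_zero hπ (by omega)).symm

theorem diagonalChain_injective (r c : ℕ) : Function.Injective
    fun π : {π : PlanePartition // ∀ i j, r ≤ i ∨ c ≤ j → π.part i j = 0} =>
      diagonalChain r c π.1 := by
  rintro ⟨π, hπ⟩ ⟨ρ, hρ⟩ h
  have h1 : ∀ k, π.diagonal r k = ρ.diagonal r k := fun k => by
    rw [← extendPath_diagonalChain hπ, ← extendPath_diagonalChain hρ]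
    exact congrArg (extendPath · k) h
  have h2 : π.part = ρ.part := by
    funext i j
    by_cases hij : r ≤ i ∨ c ≤ j
    · rw [hπ i j hij, hρ i j hij]
    · have := DFunLike.congr_fun (h1 (j + r - i)) (min i j)
      rw [diagonal_apply, diagonal_apply, show min i j + (r - (j + r - i)) = i by omega,
        show min i j + (j + r - i - r) = j by omega] at this
      exact this
  cases π
  cases ρ
  cases h2
  rfl

theorem sum_exponent {π : PlanePartition} (hπ : ∀ i j, r ≤ i ∨ c ≤ j → π.part i j = 0) :
    ∑ k ∈ Finset.range (r + c), (if k < r then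
        (r - k) * ((π.diagonal r (k + 1)).degree - (π.diagonal r k).degree)
      else (k - r) * ((π.diagonal r k).degree - (π.diagonal r (k + 1)).degree)) = π.weight := by
  rw [weight_eq_sum_degree hπ, Finset.sum_range_add, Finset.sum_range_add]
  congr 1
  · rw [← sum_sub_mul_sub (d := fun k => (π.diagonal r k).degree)
      (by rw [diagonal_eq_zero hπ (Or.inl rfl)]; rfl)
      fun k hk => (π.interlaces_diagonal_up hk).degree_le]
    exact Finset.sum_congr rfl fun k hk => if_pos (Finset.mem_range.1 hk)
  · have := sum_mul_sub_add_mul (e := fun j => (π.diagonal r (r + j)).degree) (c := c)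
      fun j _ => (π.interlaces_diagonal_down (Nat.le_add_right r j)).degree_le
    simp only [diagonal_eq_zero hπ (Or.inr (le_refl (r + c))), map_zero, mul_zero, add_zero]
      at this
    simp only [add_assoc]
    rw [← this]
    refine Finset.sum_congr rfl fun j _ => ?_
    rw [if_neg (by omega), Nat.add_sub_cancel_left]

theorem stepWeight_nonneg {q t : ℝ} (hq0 : 0 ≤ q) (hq1 : q < 1) (ht0 : 0 ≤ t) (ht1 : t < 1)
    (π : PlanePartition) (r k : ℕ) : 0 ≤ stepWeight q t π r k := by
  unfold stepWeight
  split_ifs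
  · exact (step_pos hq0 hq1 ht0 ht1 _ _).1.le
  · exact (step_pos hq0 hq1 ht0 ht1 _ _).2.le

theorem prod_upDownKernel_diagonal {q t s : ℝ} (hq0 : 0 ≤ q) (hq1 : q < 1) (ht0 : 0 ≤ t)
    (ht1 : t < 1) (hs0 : 0 ≤ s) {π : PlanePartition}
    (hπ : ∀ i j, r ≤ i ∨ c ≤ j → π.part i j = 0) :
    ∏ k ∈ Finset.range (r + c), upDownKernel q t (fun i => ENNReal.ofReal s ^ (r - i))
        (fun j => ENNReal.ofReal s ^ j) r k (π.diagonal r k) (π.diagonal r (k + 1)) =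
      ENNReal.ofReal (Fmac q t π * s ^ π.weight) := by
  have hg : ∀ n m, fmac q t n m ≠ 0 := fun n m => (fmac_pos hq0 hq1 ht0 ht1 n m).ne'
  have hw := stepWeight_nonneg hq0 hq1 ht0 ht1 π r
  rw [Fmac_eq_prod_stepWeight hg hπ, ENNReal.ofReal_mul (Finset.prod_nonneg fun k _ => hw k),
    ENNReal.ofReal_pow hs0, ENNReal.ofReal_prod_of_nonneg fun k _ => hw k, ← sum_exponent hπ,
    ← Finset.prod_pow_eq_pow_sum, ← Finset.prod_mul_distrib]
  refine Finset.prod_congr rfl fun k _ => ?_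
  unfold upDownKernel stepWeight
  split_ifs with hk
  · rw [upOp, if_pos (π.interlaces_diagonal_up hk), pow_mul]
  · rw [downOp, if_pos (π.interlaces_diagonal_down (not_lt.1 hk)), pow_mul]

theorem tsum_ofReal_Fmac_mul_pow {q t s : ℝ} (hq0 : 0 ≤ q) (hq1 : q < 1) (ht0 : 0 ≤ t)
    (ht1 : t < 1) (hs0 : 0 ≤ s) (r c : ℕ) :
    ∑' π : {π : PlanePartition // ∀ i j, r ≤ i ∨ c ≤ j → π.part i j = 0},
        ENNReal.ofReal (Fmac q t π.1 * s ^ π.1.weight) =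
      ∏ i ∈ Finset.range r, ∏ j ∈ Finset.range c,
        rowSeries q t (ENNReal.ofReal s ^ (r - i) * ENNReal.ofReal s ^ j) := by
  rw [← tsum_prod_upDownKernel hq0 hq1 ht0 ht1 (fun i => ENNReal.ofReal s ^ (r - i))
    (fun j => ENNReal.ofReal s ^ j), ← (diagonalChain_injective r c).tsum_eq]
  · refine tsum_congr fun π => ?_
    simp only [extendPath_diagonalChain π.2]
    rw [prod_upDownKernel_diagonal hq0 hq1 ht0 ht1 hs0 π.2,
      if_pos (diagonal_eq_zero π.2 (Or.inr le_rfl)), mul_one]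
  · intro L hL
    have h1 := left_ne_zero_of_mul hL
    have h2 : extendPath L (r + c) = 0 := by
      by_contra h
      exact right_ne_zero_of_mul hL (if_neg h)
    have h0 : extendPath L 0 = 0 := dif_neg fun h => lt_irrefl 0 h.1
    have hn : ∀ k, r + c ≤ k → extendPath L k = 0 := by
      intro k hk
      rcases hk.eq_or_lt with rfl | hk
      · exact h2
      · exact dif_neg fun h => by omega
    have hk := fun k (hk : k < r + c) => Finset.prod_ne_zero_iff.1 h1 k (Finset.mem_range.2 hk)
    obtain ⟨π, hπ, hE⟩ := exists_diagonal_eq h0 hn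
      (fun k hkr => by
        have := hk k (by omega)
        rw [upDownKernel, if_pos hkr] at this
        by_contra h
        exact this (if_neg h))
      (fun k hkr => by
        rcases lt_or_ge k (r + c) with hkn | hkn
        · have := hk k hkn
          rw [upDownKernel, if_neg (by omega)] at this
          by_contra h
          exact this (if_neg h)
        · rw [hn k hkn, hn (k + 1) (by omega)]
          exact fun j => ⟨le_rfl, le_rfl⟩)
    refine ⟨⟨π, hπ⟩, ?_⟩
    funext k
    simp only [diagonalChain, hE]
    exact dif_pos ⟨Nat.succ_pos _, k.2⟩

end PlanePartition

/-- **Generalized MacMahon's formula (Macdonald's case, boxed version).**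
For positive integers `r`, `c`,
`∑_{π ∈ P(r,c)} F_π(q,t) s^{|π|}
  = ∏_{i=1}^{r} ∏_{j=1}^{c} (t s^{i+j-1}; q)_∞ / (s^{i+j-1}; q)_∞`,
for real parameters `0 ≤ q, t, s < 1`.  Here `P(r,c)` is the set of plane
partitions with at most `r` rows and `c` columns. -/
theorem generalized_macmahon_macdonald_boxed
    (q t s : ℝ) (hq0 : 0 ≤ q) (hq1 : q < 1) (ht0 : 0 ≤ t) (ht1 : t < 1)
    (hs0 : 0 ≤ s) (hs1 : s < 1) (r c : ℕ) (hr : 0 < r) (hc : 0 < c) :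
    ∑' π : {π : PlanePartition // ∀ i j, r ≤ i ∨ c ≤ j → π.part i j = 0},
        Fmac q t π.1 * s ^ π.1.weight =
      ∏ i ∈ Finset.range r, ∏ j ∈ Finset.range c,
        qPoch (t * s ^ (i + j + 1)) q / qPoch (s ^ (i + j + 1)) q := by
  have h := congrArg ENNReal.toReal
    (PlanePartition.tsum_ofReal_Fmac_mul_pow hq0 hq1 ht0 ht1 hs0 r c)
  rw [ENNReal.tsum_toReal_eq fun _ => ENNReal.ofReal_ne_top, ENNReal.toReal_prod,
    ← Finset.prod_range_reflect] at h
  have hF : ∀ π : {π : PlanePartition // ∀ i j, r ≤ i ∨ c ≤ j → π.part i j = 0},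
      0 ≤ Fmac q t π.1 * s ^ π.1.weight := fun π => by
    rw [PlanePartition.Fmac_eq_prod_stepWeight
      (fun n m => (fmac_pos hq0 hq1 ht0 ht1 n m).ne') π.2]
    refine mul_nonneg (Finset.prod_nonneg fun k _ => ?_) (pow_nonneg hs0 _)
    exact PlanePartition.stepWeight_nonneg hq0 hq1 ht0 ht1 _ _ _
  simp only [ENNReal.toReal_ofReal (hF _)] at h
  rw [h]
  refine Finset.prod_congr rfl fun i hi => ?_
  rw [ENNReal.toReal_prod]
  refine Finset.prod_congr rfl fun j _ => ?_
  have := Finset.mem_range.1 hi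
  rw [← pow_add, show r - (r - 1 - i) + j = i + j + 1 by omega, ← ENNReal.ofReal_pow hs0]
  exact rowSeries_ofReal hq0 hq1 ht0 ht1 (pow_nonneg hs0 _)
    (pow_lt_one₀ hs0 hs1 (Nat.succ_ne_zero _))
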